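/- arXiv:1703.08385 — 2 statements merged into one kernel-verified Lean document; each statement's English description precedes it below -/
import Mathlib

section
/- If B : Ω → ℝ is Hölder continuous and ρ_B is the equilibrium (Gibbs) probability for B, then ρ_B is C*-Gibbs for B: for every conjugating homeomorphism (O, φ) (not only symmetric ones) and every continuous g : Ω → ℂ, ∫_{φ(O)} g dρ_B = ∫_O e^{−V(z, φ(z))} g(φ(z)) dρ_B(z). -/
open MeasureTheory Filter
open scoped ENNReal

noncomputable section

/-- The two-sided full shift space `Ω = {1,…,d}^ℤ` (alphabet `Fin d`). -/
abbrev Omega (d : ℕ) : Type := ℤ → Fin d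

/-- The shift map `τ`, `(τ x) j = x (j+1)`. -/
def tau (d : ℕ) (x : Omega d) : Omega d := fun j => x (j + 1)

/-- The `k`-th iterate of the shift (`k ∈ ℤ`): `(τ^k x) j = x (j + k)`. -/
def tauZ (d : ℕ) (k : ℤ) (x : Omega d) : Omega d := fun j => x (j + k)

/-- `x` and `y` are homoclinic: they differ in only finitely many coordinates. -/
def Homoclinic (d : ℕ) (x y : Omega d) : Prop := Set.Finite {j : ℤ | x j ≠ y j}

/-- `U` is Hölder continuous for the standard metric `dist x y = 2^{-N}`:
there are `C > 0` and `0 < θ < 1` with `|U x - U y| ≤ C θ^N` whenever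
`x` and `y` agree on all coordinates `|j| ≤ N`. -/
def HolderPotential (d : ℕ) (U : Omega d → ℝ) : Prop :=
  ∃ C θ : ℝ, 0 < C ∧ 0 < θ ∧ θ < 1 ∧
    ∀ (x y : Omega d) (N : ℕ), (∀ j : ℤ, |j| ≤ (N : ℤ) → x j = y j) →
      |U x - U y| ≤ C * θ ^ N

/-- `U` depends on only finitely many coordinates. -/
def FiniteRange (d : ℕ) (U : Omega d → ℝ) : Prop :=
  ∃ s : Finset ℤ, ∀ x y : Omega d, (∀ j ∈ s, x j = y j) → U x = U y

/-- `V(x,y) = ∑_{k ∈ ℤ} (U(τ^k x) - U(τ^k y))`. -/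
def Vfun (d : ℕ) (U : Omega d → ℝ) (x y : Omega d) : ℝ :=
  ∑' k : ℤ, (U (tauZ d k x) - U (tauZ d k y))

/-- The cylinder `{z : z_j = a_j for -n ≤ j ≤ m}`. -/
def cyl (d : ℕ) (n m : ℕ) (a : ℤ → Fin d) : Set (Omega d) :=
  {z | ∀ j : ℤ, -(n : ℤ) ≤ j → j ≤ (m : ℤ) → z j = a j}

/-- The conjugating homeomorphism with window `-n ≤ j ≤ m` and target word `b`:
it replaces the coordinates in the window by those of `b` and keeps the rest. -/
def conjMap (d : ℕ) (n m : ℕ) (b : ℤ → Fin d) (z : Omega d) : Omega d :=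
  fun j => if -(n : ℤ) ≤ j ∧ j ≤ (m : ℤ) then b j else z j

/-- `α` is a C*-Gibbs measure for `U` (at inverse temperature `β = 1`):
for every symmetric conjugating homeomorphism `(O, φ)` and every continuous
`f : Ω → ℂ`, `∫_O e^{-V(z, φ z)} f(φ z) dα = ∫_{φ(O)} f dα`. -/
def CStarGibbs (d : ℕ) (U : Omega d → ℝ) (α : Measure (Omega d)) : Prop :=
  ∀ n : ℕ, 1 ≤ n → ∀ (a b : ℤ → Fin d) (f : Omega d → ℂ), Continuous f →
    ∫ z in cyl d n n a,
        (Real.exp (-(Vfun d U z (conjMap d n n b z))) : ℂ) * f (conjMap d n n b z) ∂α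
      = ∫ z in cyl d n n b, f z ∂α

/-- `α` is a quasi-C*-Gibbs measure for `U`: there are constants `d₁, d₂ > 0`
such that for every conjugating homeomorphism `(O, φ)` and every nonnegative
continuous `f : Ω → ℝ`,
`d₁ ∫_O e^{-V(z,φz)} f(φ z) dα ≤ ∫_{φ(O)} f dα ≤ d₂ ∫_O e^{-V(z,φz)} f(φ z) dα`. -/
def QuasiCStarGibbs (d : ℕ) (U : Omega d → ℝ) (α : Measure (Omega d)) : Prop :=
  ∃ d₁ d₂ : ℝ, 0 < d₁ ∧ 0 < d₂ ∧
    ∀ (n m : ℕ), 1 ≤ n → 1 ≤ m → ∀ (a b : ℤ → Fin d) (f : Omega d → ℝ),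
      Continuous f → (∀ z, 0 ≤ f z) →
      (d₁ * ∫ z in cyl d n m a,
          Real.exp (-(Vfun d U z (conjMap d n m b z))) * f (conjMap d n m b z) ∂α
        ≤ ∫ z in cyl d n m b, f z ∂α) ∧
      (∫ z in cyl d n m b, f z ∂α
        ≤ d₂ * ∫ z in cyl d n m a,
            Real.exp (-(Vfun d U z (conjMap d n m b z))) * f (conjMap d n m b z) ∂α)

/-- The future cylinder `{z : z_k = a_k for 1 ≤ k ≤ s}`. -/
def futureCyl (d : ℕ) (s : ℕ) (a : ℕ → Fin d) : Set (Omega d) :=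
  {z | ∀ k : ℕ, 1 ≤ k → k ≤ s → z (k : ℤ) = a k}

/-- The Birkhoff sum `∑_{k=0}^{s-1} U(τ^k x)`. -/
def birkhoff (d : ℕ) (U : Omega d → ℝ) (s : ℕ) (x : Omega d) : ℝ :=
  ∑ k ∈ Finset.range s, U (tauZ d (k : ℤ) x)

/-- `ρ` is the equilibrium (Gibbs) probability for `U`: it is `τ`-invariant and
satisfies Bowen's inequalities. -/
def IsEquilibrium (d : ℕ) (U : Omega d → ℝ) (ρ : Measure (Omega d)) : Prop :=
  Measure.map (tau d) ρ = ρ ∧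
  ∃ C₁ C₂ P : ℝ, 0 < C₁ ∧ 0 < C₂ ∧
    ∀ s : ℕ, 1 ≤ s → ∀ (a : ℕ → Fin d) (x : Omega d),
      (∀ k : ℕ, 1 ≤ k → k ≤ s → x (k : ℤ) = a k) →
      C₁ ≤ (ρ (futureCyl d s a)).toReal * Real.exp (P * s - birkhoff d U s x) ∧
      (ρ (futureCyl d s a)).toReal * Real.exp (P * s - birkhoff d U s x) ≤ C₂

/-- The point whose coordinates `1, 2, 3, …` are `j, x₁, x₂, …`. -/
def prepend (d : ℕ) (j : Fin d) (x : Omega d) : Omega d :=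
  fun k => if k = 1 then j else x (k - 1)

/-- A potential depending on the coordinates `x₁, …, x_r` is normalized if
`∑_{j=1}^d exp(f(j, x₁, …, x_{r-1})) = 1` for all choices of `x₁, …, x_{r-1}`. -/
def Normalized (d : ℕ) (U : Omega d → ℝ) : Prop :=
  ∀ x : Omega d, ∑ j : Fin d, Real.exp (U (prepend d j x)) = 1

section Potential

variable {d : ℕ}

lemma continuous_tauZ (k : ℤ) : Continuous (tauZ d k) :=
  continuous_pi fun j => continuous_apply (j + k)

@[simp]
lemma tauZ_tauZ (k l : ℤ) (x : Omega d) : tauZ d k (tauZ d l x) = tauZ d (k + l) x := by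
  funext j
  simp only [tauZ, add_assoc]

@[simp]
lemma tauZ_zero (x : Omega d) : tauZ d 0 x = x := by
  funext j
  simp [tauZ]

/-- The integer power `τ^k` of the shift as a homeomorphism. -/
def shiftHomeo (d : ℕ) (k : ℤ) : Omega d ≃ₜ Omega d where
  toFun := tauZ d k
  invFun := tauZ d (-k)
  left_inv x := by simp
  right_inv x := by simp
  continuous_toFun := continuous_tauZ k
  continuous_invFun := continuous_tauZ (-k)

lemma map_tauZ_eq {ρ : Measure (Omega d)} (h : ρ.map (tau d) = ρ) (k : ℤ) :
    ρ.map (tauZ d k) = ρ := by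
  have hnat (n : ℕ) : ρ.map (tauZ d n) = ρ := by
    induction n with
    | zero =>
      have : tauZ d ((0 : ℕ) : ℤ) = id := funext fun x => by simp
      rw [this, Measure.map_id]
    | succ n ih =>
      have : tauZ d ((n + 1 : ℕ) : ℤ) = tau d ∘ tauZ d n := by
        funext x j
        simp only [tauZ, tau, Function.comp_apply]
        congr 1
        push_cast
        ring
      have htau : Measurable (tau d) := (continuous_tauZ 1).measurable
      rw [this, ← Measure.map_map htau (continuous_tauZ n).measurable,
        ih, h]
  obtain ⟨n, rfl | rfl⟩ := k.eq_nat_or_neg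
  · exact hnat n
  · conv_lhs => rw [← hnat n]
    rw [Measure.map_map (continuous_tauZ _).measurable (continuous_tauZ _).measurable]
    have : tauZ d (-(n : ℤ)) ∘ tauZ d n = id := by
      funext x
      simp
    rw [this, Measure.map_id]

lemma eventually_agree (x : Omega d) (N : ℕ) :
    ∀ᶠ y in nhds x, ∀ j : ℤ, |j| ≤ (N : ℤ) → x j = y j := by
  have h : ∀ j ∈ Finset.Icc (-(N : ℤ)) N, ∀ᶠ y in nhds x, x j = y j := by
    intro j _
    filter_upwards [(continuous_apply j).continuousAt.eventually_mem
      (show ({x j} : Set (Fin d)) ∈ nhds (x j) by simp)] with y hy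
    exact (Set.mem_singleton_iff.1 hy).symm
  filter_upwards [(Finset.eventually_all _).2 h] with y hy j hj
  exact hy j (Finset.mem_Icc.2 (abs_le.1 hj))

lemma HolderPotential.continuous {U : Omega d → ℝ} (hU : HolderPotential d U) :
    Continuous U := by
  obtain ⟨C, θ, hC, hθ0, hθ1, h⟩ := hU
  refine continuous_iff_continuousAt.2 fun x => Metric.tendsto_nhds.2 fun ε hε => ?_
  have hlim : Tendsto (fun N : ℕ => C * θ ^ N) atTop (nhds 0) := by
    simpa using (tendsto_pow_atTop_nhds_zero_of_lt_one hθ0.le hθ1).const_mul C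
  obtain ⟨N, hN⟩ := (hlim.eventually (gt_mem_nhds hε)).exists
  filter_upwards [eventually_agree x N] with y hy
  rw [dist_comm, Real.dist_eq]
  exact (h x y N hy).trans_lt hN

@[simp]
lemma tauZ_add (k : ℤ) (x y : Omega d) : tauZ d k (x + y) = tauZ d k x + tauZ d k y := rfl

variable [NeZero d]

lemma Homoclinic.shift {u : Omega d} (hu : Homoclinic d u 0) (k : ℤ) :
    Homoclinic d (tauZ d k u) 0 :=
  Set.Finite.preimage (f := fun j : ℤ => j + k) (add_left_injective k).injOn hu

lemma Homoclinic.add {u v : Omega d} (hu : Homoclinic d u 0) (hv : Homoclinic d v 0) :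
    Homoclinic d (u + v) 0 := by
  refine (Set.Finite.union hu hv).subset fun j hj => ?_
  simp only [Set.mem_union, Set.mem_ofPred_eq, Pi.add_apply, Pi.zero_apply] at hj ⊢
  by_contra! h
  exact hj (by rw [h.1, h.2, add_zero])

lemma Homoclinic.neg {u : Omega d} (hu : Homoclinic d u 0) : Homoclinic d (-u) 0 := by
  refine Set.Finite.subset hu fun j hj => ?_
  simpa using hj

lemma homoclinic_zero : Homoclinic d 0 0 := by
  simp [Homoclinic]

lemma Homoclinic.exists_bound {u : Omega d} (hu : Homoclinic d u 0) :
    ∃ M : ℕ, ∀ j : ℤ, (M : ℤ) < |j| → u j = 0 := by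
  obtain ⟨M, hM⟩ := (hu.image Int.natAbs).bddAbove
  refine ⟨M, fun j hj => ?_⟩
  by_contra h
  have := hM (Set.mem_image_of_mem Int.natAbs h)
  rw [Int.abs_eq_natAbs] at hj
  omega

/-- The differences `B(τ^k(x+u)) - B(τ^k x)` are dominated, uniformly in `x`, by a summable
family. -/
lemma HolderPotential.exists_summable_bound {U : Omega d → ℝ} (hU : HolderPotential d U)
    {u : Omega d} (hu : Homoclinic d u 0) :
    ∃ c : ℤ → ℝ, Summable c ∧
      ∀ (k : ℤ) (x : Omega d), ‖U (tauZ d k (x + u)) - U (tauZ d k x)‖ ≤ c k := by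
  obtain ⟨S, hS⟩ := isCompact_univ.exists_bound_of_continuousOn hU.continuous.continuousOn
  obtain ⟨C, θ, hC, hθ0, hθ1, h⟩ := hU
  obtain ⟨M, hM⟩ := hu.exists_bound
  have hS0 : 0 ≤ S := (norm_nonneg _).trans (hS 0 (Set.mem_univ _))
  have hsum : Summable fun n : ℕ => (2 * S + C) * θ ^ (n - (M + 1)) := by
    refine Summable.mul_left _ ((summable_nat_add_iff (M + 1)).1 ?_)
    simpa using summable_geometric_of_lt_one hθ0.le hθ1
  refine ⟨fun k => (2 * S + C) * θ ^ (k.natAbs - (M + 1)), ?_, fun k x => ?_⟩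
  · exact Summable.of_nat_of_neg (by simpa using hsum) (by simpa using hsum)
  · beta_reduce
    by_cases hk : k.natAbs ≤ M
    · have : k.natAbs - (M + 1) = 0 := by omega
      rw [this, pow_zero, mul_one]
      calc _ ≤ ‖U (tauZ d k (x + u))‖ + ‖U (tauZ d k x)‖ := norm_sub_le _ _
        _ ≤ S + S := add_le_add (hS _ (Set.mem_univ _)) (hS _ (Set.mem_univ _))
        _ ≤ _ := by linarith
    · refine (h _ _ (k.natAbs - (M + 1)) fun j hj => ?_).trans ?_
      · have : u (j + k) = 0 := hM _ (by
          rw [Int.abs_eq_natAbs] at hj ⊢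
          omega)
        simp [tauZ, this]
      · gcongr
        linarith

/-- The cocycle `W_u(x) = V(x + u, x)` of the translation by `u`. -/
def energy (d : ℕ) [NeZero d] (U : Omega d → ℝ) (u x : Omega d) : ℝ :=
  Vfun d U (x + u) x

variable {U : Omega d → ℝ} {u v : Omega d}

lemma HolderPotential.summable_energy (hU : HolderPotential d U) (hu : Homoclinic d u 0)
    (x : Omega d) : Summable fun k : ℤ => U (tauZ d k (x + u)) - U (tauZ d k x) := by
  obtain ⟨c, hc, h⟩ := hU.exists_summable_bound hu
  exact Summable.of_norm_bounded hc fun k => h k x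

lemma HolderPotential.continuous_energy (hU : HolderPotential d U) (hu : Homoclinic d u 0) :
    Continuous (energy d U u) := by
  obtain ⟨c, hc, h⟩ := hU.exists_summable_bound hu
  have hc := hU.continuous
  refine continuous_tsum (fun k => ?_) ‹_› h
  exact (hc.comp ((continuous_tauZ k).comp (continuous_add_const u))).sub
    (hc.comp (continuous_tauZ k))

lemma HolderPotential.energy_add (hU : HolderPotential d U) (hu : Homoclinic d u 0)
    (hv : Homoclinic d v 0) (x : Omega d) :
    energy d U (u + v) x = energy d U u (x + v) + energy d U v x := by
  rw [energy, energy, energy, Vfun, Vfun, Vfun,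
    ← (hU.summable_energy hu (x + v)).tsum_add (hU.summable_energy hv x)]
  refine tsum_congr fun k => ?_
  rw [sub_add_sub_cancel, add_assoc, add_comm u v]

@[simp]
lemma energy_zero (x : Omega d) : energy d U 0 x = 0 := by
  simp [energy, Vfun]

lemma energy_tauZ (k : ℤ) (x : Omega d) :
    energy d U (tauZ d k u) (tauZ d k x) = energy d U u x := by
  rw [energy, energy, Vfun, Vfun, ← tauZ_add,
    ← (Equiv.addRight k).tsum_eq fun l : ℤ => U (tauZ d l (x + u)) - U (tauZ d l x)]
  simp

lemma Vfun_add_right (x : Omega d) : Vfun d U x (x + u) = -energy d U u x := by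
  rw [energy, Vfun, Vfun, ← tsum_neg]
  simp

/-- The Birkhoff differences over long windows approximate the energy, uniformly in `x`. -/
lemma HolderPotential.eventually_abs_sum_sub_energy_le (hU : HolderPotential d U)
    (hu : Homoclinic d u 0) :
    ∀ᶠ N : ℕ in atTop, ∀ x : Omega d,
      |∑ k ∈ Finset.Ico (-(N : ℤ) - 1) N, (U (tauZ d k (x + u)) - U (tauZ d k x))
        - energy d U u x| ≤ 1 := by
  obtain ⟨c, hc, h⟩ := hU.exists_summable_bound hu
  have hunif := Metric.tendstoUniformly_iff.1 (tendstoUniformly_tsum hc h) 1 one_pos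
  have hIco : Tendsto (fun N : ℕ => Finset.Ico (-(N : ℤ) - 1) N) atTop atTop := by
    refine tendsto_atTop_finset_of_monotone (fun a b hab => ?_) fun k => ⟨k.natAbs + 1, ?_⟩
    · exact Finset.Ico_subset_Ico (by omega) (by omega)
    · rw [Finset.mem_Ico]
      omega
  filter_upwards [hIco.eventually hunif] with N hN x
  have := hN x
  rw [dist_comm, Real.dist_eq] at this
  exact this.le

end Potential

section Translation

variable {d : ℕ} [NeZero d] {U : Omega d → ℝ} {u v : Omega d}

/-- The transform of `α` by the translation by `-u`, weighted by `e^{-W_u}`. The C*-Gibbs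
measures for `U` are the measures fixed by all of these. -/
def gibbsTransport (d : ℕ) [NeZero d] (U : Omega d → ℝ) (u : Omega d)
    (α : Measure (Omega d)) : Measure (Omega d) :=
  (α.map fun x => x - u).withDensity fun x => ENNReal.ofReal (Real.exp (-energy d U u x))

lemma map_homeomorph_withDensity {X Y : Type*} [TopologicalSpace X] [MeasurableSpace X]
    [BorelSpace X] [TopologicalSpace Y] [MeasurableSpace Y] [BorelSpace Y] (e : X ≃ₜ Y)
    (α : Measure X) (f : X → ℝ≥0∞) :
    (α.withDensity f).map e = (α.map e).withDensity (f ∘ e.symm) := by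
  ext s hs
  rw [Measure.map_apply e.measurable hs, withDensity_apply _ (e.measurable hs),
    withDensity_apply _ hs, Measure.restrict_map e.measurable hs,
    e.measurableEmbedding.lintegral_map]
  simp

lemma measurable_sub_right (u : Omega d) : Measurable fun x : Omega d => x - u :=
  (Homeomorph.subRight u).measurable

lemma HolderPotential.measurable_density (hU : HolderPotential d U) (hu : Homoclinic d u 0) :
    Measurable fun x => ENNReal.ofReal (Real.exp (-energy d U u x)) :=
  (Real.continuous_exp.comp (hU.continuous_energy hu).neg).measurable.ennreal_ofReal

lemma gibbsTransport_mono {α β : Measure (Omega d)} (h : α ≤ β) :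
    gibbsTransport d U u α ≤ gibbsTransport d U u β :=
  Measure.le_iff.2 fun s hs => by
    rw [gibbsTransport, gibbsTransport, withDensity_apply _ hs, withDensity_apply _ hs]
    exact lintegral_mono' (Measure.restrict_mono le_rfl
      (Measure.map_mono h (measurable_sub_right u))) le_rfl

@[simp]
lemma gibbsTransport_zero (α : Measure (Omega d)) : gibbsTransport d U 0 α = α := by
  simp [gibbsTransport]

lemma HolderPotential.gibbsTransport_gibbsTransport (hU : HolderPotential d U)
    (hu : Homoclinic d u 0) (hv : Homoclinic d v 0) (α : Measure (Omega d)) :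
    gibbsTransport d U v (gibbsTransport d U u α) = gibbsTransport d U (u + v) α := by
  have hmap := map_homeomorph_withDensity (Homeomorph.subRight v) (α.map fun x => x - u)
    fun x => ENNReal.ofReal (Real.exp (-energy d U u x))
  rw [Homeomorph.coe_subRight] at hmap
  have hm := hU.measurable_density hu
  rw [gibbsTransport, gibbsTransport, hmap, gibbsTransport,
    Measure.map_map (measurable_sub_right v) (measurable_sub_right u),
    ← withDensity_mul _ (hm.comp (Homeomorph.subRight v).symm.measurable)
      (hU.measurable_density hv)]
  congr 1
  · congr 1
    funext x
    exact sub_sub x u v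
  · funext x
    simp only [Pi.mul_apply, Function.comp_apply]
    rw [← ENNReal.ofReal_mul (Real.exp_pos _).le, ← Real.exp_add, hU.energy_add hu hv,
      neg_add]
    rfl

lemma map_tauZ_gibbsTransport (k : ℤ) (α : Measure (Omega d)) :
    (gibbsTransport d U u α).map (tauZ d k)
      = gibbsTransport d U (tauZ d k u) (α.map (tauZ d k)) := by
  have hmap := map_homeomorph_withDensity (shiftHomeo d k) (α.map fun x => x - u)
    fun x => ENNReal.ofReal (Real.exp (-energy d U u x))
  have hk : (shiftHomeo d k : Omega d → Omega d) = tauZ d k := rfl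
  rw [hk] at hmap
  rw [gibbsTransport, hmap, gibbsTransport,
    Measure.map_map (continuous_tauZ k).measurable (measurable_sub_right u),
    Measure.map_map (measurable_sub_right _)
      (continuous_tauZ k).measurable]
  congr 1
  funext x
  have := energy_tauZ (U := U) (u := u) k (tauZ d (-k) x)
  simp only [tauZ_tauZ, add_neg_cancel, tauZ_zero] at this
  rw [this]
  rfl

/-- The least measure above `ρ` that is fixed by all the weighted translations. -/
def gibbsHull (d : ℕ) [NeZero d] (U : Omega d → ℝ) (ρ : Measure (Omega d)) :
    Measure (Omega d) :=
  ⨆ (u : Omega d) (_ : Homoclinic d u 0), gibbsTransport d U u ρ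

variable {ρ : Measure (Omega d)}

lemma gibbsTransport_le_gibbsHull (hu : Homoclinic d u 0) :
    gibbsTransport d U u ρ ≤ gibbsHull d U ρ :=
  le_iSup₂_of_le u hu le_rfl

lemma le_gibbsHull : ρ ≤ gibbsHull d U ρ := by
  simpa using gibbsTransport_le_gibbsHull (U := U) (ρ := ρ) homoclinic_zero

lemma HolderPotential.gibbsTransport_gibbsHull (hU : HolderPotential d U)
    (hv : Homoclinic d v 0) :
    gibbsTransport d U v (gibbsHull d U ρ) = gibbsHull d U ρ := by
  have hle (w : Omega d) (hw : Homoclinic d w 0) :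
      gibbsHull d U ρ ≤ gibbsTransport d U w (gibbsHull d U ρ) := by
    refine iSup₂_le fun u hu => ?_
    have h := hU.gibbsTransport_gibbsTransport (hu.add hw.neg) hw ρ
    rw [neg_add_cancel_right] at h
    rw [← h]
    exact gibbsTransport_mono (gibbsTransport_le_gibbsHull (hu.add hw.neg))
  refine le_antisymm ?_ (hle v hv)
  have h := gibbsTransport_mono (U := U) (u := v) (hle (-v) hv.neg)
  rwa [hU.gibbsTransport_gibbsTransport hv.neg hv, neg_add_cancel, gibbsTransport_zero] at h

lemma map_tauZ_gibbsHull (hρ : ∀ k, ρ.map (tauZ d k) = ρ) [IsFiniteMeasure (gibbsHull d U ρ)]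
    (k : ℤ) : (gibbsHull d U ρ).map (tauZ d k) = gibbsHull d U ρ := by
  have hm := (continuous_tauZ (d := d) k).measurable
  have hle : gibbsHull d U ρ ≤ (gibbsHull d U ρ).map (tauZ d k) := by
    refine iSup₂_le fun u hu => ?_
    have h := map_tauZ_gibbsTransport (U := U) (u := tauZ d (-k) u) k ρ
    rw [hρ, tauZ_tauZ, add_neg_cancel, tauZ_zero] at h
    rw [← h]
    exact Measure.map_mono (gibbsTransport_le_gibbsHull (hu.shift _)) hm
  refine (Measure.eq_of_le_of_measure_univ_eq hle ?_).symm
  rw [Measure.map_apply hm MeasurableSet.univ, Set.preimage_univ]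

end Translation

section Cylinders

variable {d : ℕ}

lemma measurableSet_cyl (n m : ℕ) (a : ℤ → Fin d) : MeasurableSet (cyl d n m a) := by
  have : cyl d n m a = ⋂ (j : ℤ) (_ : -(n : ℤ) ≤ j) (_ : j ≤ (m : ℤ)),
      (fun z : Omega d => z j) ⁻¹' {a j} := by
    ext z
    simp [cyl]
  rw [this]
  exact MeasurableSet.iInter fun j => MeasurableSet.iInter fun _ => MeasurableSet.iInter fun _ =>
    measurable_pi_apply j (measurableSet_singleton _)

lemma self_mem_cyl (n m : ℕ) (x : Omega d) : x ∈ cyl d n m x := fun _ _ _ => rfl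

lemma cyl_eq_of_mem {n m : ℕ} {x z : Omega d} (h : z ∈ cyl d n m x) :
    cyl d n m z = cyl d n m x := by
  ext w
  refine forall_congr' fun j => forall_congr' fun h1 => forall_congr' fun h2 => ?_
  rw [h j h1 h2]

lemma measure_le_of_forall_cyl_subset {α β : Measure (Omega d)} {N : ℕ}
    (h : ∀ x, α (cyl d N N x) ≤ β (cyl d N N x)) {s : Set (Omega d)}
    (hs : ∀ x ∈ s, cyl d N N x ⊆ s) : α s ≤ β s := by
  classical
  let r : Omega d → Finset.Icc (-(N : ℤ)) N → Fin d := fun x j => x j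
  have hr (x : Omega d) : r ⁻¹' {r x} = cyl d N N x := by
    ext z
    simp only [Set.mem_preimage, Set.mem_singleton_iff, cyl, Set.mem_ofPred_eq, r, funext_iff,
      Subtype.forall, Finset.mem_Icc, and_imp]
  have hsr : r ⁻¹' ((r '' s).toFinset : Set _) = s := by
    rw [Set.coe_toFinset]
    refine Set.Subset.antisymm (fun z hz => ?_) (Set.subset_preimage_image r s)
    obtain ⟨x, hx, hxz⟩ := hz
    refine hs x hx ?_
    rw [← hr]
    exact hxz.symm
  have hm : ∀ w ∈ (r '' s).toFinset, MeasurableSet (r ⁻¹' {w}) := by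
    intro w hw
    obtain ⟨x, -, rfl⟩ := Set.mem_toFinset.1 hw
    rw [hr]
    exact measurableSet_cyl N N x
  rw [← hsr, ← sum_measure_preimage_singleton _ hm, ← sum_measure_preimage_singleton _ hm]
  refine Finset.sum_le_sum fun w hw => ?_
  obtain ⟨x, -, rfl⟩ := Set.mem_toFinset.1 hw
  rw [hr]
  exact h x

lemma measure_le_of_eventually_cyl_le {α β : Measure (Omega d)} [β.OuterRegular]
    (h : ∀ᶠ N : ℕ in atTop, ∀ x, α (cyl d N N x) ≤ β (cyl d N N x)) : α ≤ β := by
  have hopen (s : Set (Omega d)) (hs : IsOpen s) : α s ≤ β s := by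
    let t : ℕ → Set (Omega d) := fun N => {x | cyl d N N x ⊆ s}
    have hmono : Monotone t := fun M N hMN x hx z hz =>
      hx fun j h1 h2 => hz j (by omega) (by omega)
    have hunion : ⋃ N, t N = s := by
      refine Set.Subset.antisymm (Set.iUnion_subset fun N x hx => hx (self_mem_cyl N N x)) ?_
      intro x hx
      obtain ⟨I, v, hv, hsub⟩ := isOpen_pi_iff.1 hs x hx
      refine Set.mem_iUnion.2 ⟨I.sup Int.natAbs, fun z hz => hsub fun j hj => ?_⟩
      have hle := Finset.le_sup (f := Int.natAbs) hj
      rw [hz j (by omega) (by omega)]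
      exact (hv j hj).2
    rw [← hunion]
    refine le_of_tendsto_of_tendsto (tendsto_measure_iUnion_atTop hmono)
      (tendsto_measure_iUnion_atTop hmono) ?_
    filter_upwards [h] with N hN
    refine measure_le_of_forall_cyl_subset hN fun x hx z hz => ?_
    exact (cyl_eq_of_mem hz).trans_subset hx
  refine Measure.le_iff'.2 fun s => ?_
  rw [s.measure_eq_iInf_isOpen β]
  exact le_iInf₂ fun t hst => le_iInf fun ht => (measure_mono hst).trans (hopen t ht)

/-- Bowen's inequalities for the symmetric windows `-N ≤ j ≤ N`. -/
lemma IsEquilibrium.exists_bounds {U : Omega d → ℝ} {ρ : Measure (Omega d)}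
    (h : IsEquilibrium d U ρ) :
    ∃ C₁ C₂ P : ℝ, 0 < C₁ ∧ 0 < C₂ ∧ ∀ (N : ℕ) (x : Omega d),
      C₁ ≤ (ρ (cyl d N N x)).toReal
        * Real.exp (P * (2 * N + 1 : ℕ) - ∑ k ∈ Finset.Ico (-(N : ℤ) - 1) N, U (tauZ d k x)) ∧
      (ρ (cyl d N N x)).toReal
        * Real.exp (P * (2 * N + 1 : ℕ) - ∑ k ∈ Finset.Ico (-(N : ℤ) - 1) N, U (tauZ d k x))
        ≤ C₂ := by
  obtain ⟨hinv, C₁, C₂, P, hC₁, hC₂, hb⟩ := h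
  refine ⟨C₁, C₂, P, hC₁, hC₂, fun N x => ?_⟩
  have key := hb (2 * N + 1) (by omega) (fun k => x (k - (N + 1)))
    (tauZ d (-(N + 1)) x) (fun k _ _ => by simp [tauZ, sub_eq_add_neg])
  have hcyl : futureCyl d (2 * N + 1) (fun k => x (k - (N + 1)))
      = tauZ d (N + 1) ⁻¹' cyl d N N x := by
    ext z
    simp only [futureCyl, cyl, tauZ, Set.mem_ofPred_eq, Set.mem_preimage]
    refine ⟨fun hz j h1 h2 => ?_, fun hz k h1 h2 => ?_⟩
    · have := hz (j + (N + 1)).toNat (by omega) (by omega)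
      rwa [Int.toNat_of_nonneg (by omega), add_sub_cancel_right] at this
    · have := hz (k - (N + 1)) (by omega) (by omega)
      rwa [sub_add_cancel] at this
  have hsum : birkhoff d U (2 * N + 1) (tauZ d (-(N + 1)) x)
      = ∑ k ∈ Finset.Ico (-(N : ℤ) - 1) N, U (tauZ d k x) := by
    refine Finset.sum_nbij' (fun k => (k : ℤ) - (N + 1)) (fun k => (k + (N + 1)).toNat)
      (fun k hk => ?_) (fun k hk => ?_) (fun k hk => ?_) (fun k hk => ?_) fun k hk => ?_
    · rw [Finset.mem_range] at hk
      rw [Finset.mem_Ico]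
      omega
    · rw [Finset.mem_Ico] at hk
      rw [Finset.mem_range]
      omega
    · omega
    · rw [Finset.mem_Ico] at hk
      omega
    · rw [tauZ_tauZ, sub_eq_add_neg]
  rwa [hcyl, hsum, ← Measure.map_apply (continuous_tauZ _).measurable (measurableSet_cyl N N x),
    map_tauZ_eq hinv] at key

lemma IsEquilibrium.exists_gibbsTransport_le [NeZero d] {U : Omega d → ℝ}
    {ρ : Measure (Omega d)} [IsFiniteMeasure ρ] (hU : HolderPotential d U)
    (h : IsEquilibrium d U ρ) :
    ∃ D : ℝ, ∀ u, Homoclinic d u 0 → gibbsTransport d U u ρ ≤ ENNReal.ofReal D • ρ := by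
  obtain ⟨C₁, C₂, P, hC₁, hC₂, hb⟩ := h.exists_bounds
  refine ⟨Real.exp 1 * C₂ / C₁, fun u hu => ?_⟩
  set D := Real.exp 1 * C₂ / C₁
  have hD : 0 < D := by positivity
  have : IsFiniteMeasure (ENNReal.ofReal D • ρ) := Measure.smul_finite ρ ENNReal.ofReal_ne_top
  refine measure_le_of_eventually_cyl_le ?_
  filter_upwards [hU.eventually_abs_sum_sub_energy_le hu] with N hN x
  set p := (ρ (cyl d N N x)).toReal
  set q := (ρ (cyl d N N (x + u))).toReal
  have hq : 0 < q := pos_of_mul_pos_left (hC₁.trans_le (hb N (x + u)).1) (Real.exp_pos _).le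
  have hpre : (fun z : Omega d => z - u) ⁻¹' cyl d N N x = cyl d N N (x + u) := by
    ext z
    refine forall_congr' fun j => forall_congr' fun h1 => forall_congr' fun h2 => ?_
    exact sub_eq_iff_eq_add
  have hle : ∀ z ∈ cyl d N N x, Real.exp (-energy d U u z) ≤ D * p / q := by
    intro z hz
    have h1 := (hb N z).1
    have h2 := (hb N (z + u)).2
    have hzu : z + u ∈ cyl d N N (x + u) := by
      rw [← hpre]
      simpa using hz
    rw [cyl_eq_of_mem hz] at h1
    rw [cyl_eq_of_mem hzu] at h2
    have h3 := (abs_le.1 (hN z)).2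
    rw [Finset.sum_sub_distrib] at h3
    generalize (∑ k ∈ Finset.Ico (-(N : ℤ) - 1) N, U (tauZ d k z)) = S at h1 h3
    generalize (∑ k ∈ Finset.Ico (-(N : ℤ) - 1) N, U (tauZ d k (z + u))) = S' at h2 h3
    generalize P * (2 * N + 1 : ℕ) = R at h1 h2
    change C₁ ≤ p * _ at h1
    change q * _ ≤ C₂ at h2
    rw [le_div_iff₀ hq]
    have h4 : Real.exp (-energy d U u z) ≤ Real.exp (R - S') * Real.exp 1 * Real.exp (S - R) := by
      rw [← Real.exp_add, ← Real.exp_add]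
      exact Real.exp_le_exp.2 (by linarith)
    have h5 : Real.exp (S - R) ≤ p / C₁ := by
      rw [le_div_iff₀ hC₁]
      calc Real.exp (S - R) * C₁ ≤ Real.exp (S - R) * (p * Real.exp (R - S)) := by gcongr
        _ = p * Real.exp (S - R + (R - S)) := by rw [Real.exp_add]; ring
        _ = p := by simp
    calc Real.exp (-energy d U u z) * q
        ≤ Real.exp (R - S') * Real.exp 1 * Real.exp (S - R) * q := by gcongr
      _ = q * Real.exp (R - S') * (Real.exp 1 * Real.exp (S - R)) := by ring
      _ ≤ C₂ * (Real.exp 1 * (p / C₁)) := by gcongr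
      _ = D * p := by simp only [D]; ring
  calc gibbsTransport d U u ρ (cyl d N N x)
      = ∫⁻ z in cyl d N N x, ENNReal.ofReal (Real.exp (-energy d U u z))
          ∂(ρ.map fun z => z - u) := withDensity_apply _ (measurableSet_cyl N N x)
    _ ≤ ∫⁻ _ in cyl d N N x, ENNReal.ofReal (D * p / q) ∂(ρ.map fun z => z - u) :=
        setLIntegral_mono' (measurableSet_cyl N N x) fun z hz =>
          ENNReal.ofReal_le_ofReal (hle z hz)
    _ = ENNReal.ofReal (D * p / q) * ρ (cyl d N N (x + u)) := by
        rw [setLIntegral_const, Measure.map_apply (measurable_sub_right u)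
          (measurableSet_cyl N N x), hpre]
    _ = ENNReal.ofReal (D * p) := by
        rw [← ENNReal.ofReal_toReal (measure_ne_top ρ (cyl d N N (x + u))),
          ← ENNReal.ofReal_mul (by positivity)]
        congr 1
        exact div_mul_cancel₀ _ hq.ne'
    _ = (ENNReal.ofReal D • ρ) (cyl d N N x) := by
        rw [ENNReal.ofReal_mul hD.le, ENNReal.ofReal_toReal (measure_ne_top ρ _)]
        rfl

end Cylinders

section Invariance

variable {d : ℕ} [NeZero d] {U : Omega d → ℝ} {v : Omega d}

lemma Homoclinic.tendsto_tauZ (hv : Homoclinic d v 0) :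
    Tendsto (fun k : ℕ => tauZ d k v) atTop (nhds 0) := by
  obtain ⟨M, hM⟩ := hv.exists_bound
  refine tendsto_pi_nhds.2 fun j => tendsto_const_nhds.congr' ?_
  filter_upwards [eventually_ge_atTop (M + j.natAbs + 1)] with k hk
  refine (hM (j + k) ?_).symm
  rw [Int.abs_eq_natAbs]
  omega

/-- A shift-invariant integrable function is invariant under finite changes of coordinates
that preserve the measure class. -/
lemma ae_add_eq_of_shift_invariant {μ : Measure (Omega d)} [IsFiniteMeasure μ]
    (hμ : ∀ k, μ.map (tauZ d k) = μ) {K : Omega d → ℝ} (hKm : Measurable K)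
    (hKi : Integrable K μ) (hK : ∀ k, K ∘ tauZ d k =ᵐ[μ] K) (hv : Homoclinic d v 0)
    {D : ℝ≥0∞} (hD : D ≠ ∞) (hquasi : (μ.map fun x => x + v) ≤ D • μ) :
    (fun x => K (x + v)) =ᵐ[μ] K := by
  have hτ (k : ℤ) : Measurable (tauZ d k) := (continuous_tauZ k).measurable
  have hadd (w : Omega d) : Measurable fun x : Omega d => x + w :=
    (continuous_add_const w).measurable
  have hbound : ∀ ε : ℝ≥0∞, ε ≠ 0 →
      ∫⁻ x, ‖K (x + v) - K x‖ₑ ∂μ ≤ (D + 1) * ε := by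
    intro ε hε
    obtain ⟨f, hf, -⟩ := hKi.exists_boundedContinuous_lintegral_sub_le hε
    have hfm : Measurable f := f.continuous.measurable
    have happrox (k : ℤ) : ∫⁻ x, ‖K x - f (tauZ d k x)‖ₑ ∂μ ≤ ε := by
      calc ∫⁻ x, ‖K x - f (tauZ d k x)‖ₑ ∂μ
          = ∫⁻ x, ‖K (tauZ d k x) - f (tauZ d k x)‖ₑ ∂μ := by
            refine lintegral_congr_ae ?_
            filter_upwards [hK k] with x hx
            rw [← hx]
            rfl
        _ = ∫⁻ y, ‖K y - f y‖ₑ ∂(μ.map (tauZ d k)) :=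
            (lintegral_map (hKm.sub hfm).enorm (hτ k)).symm
        _ ≤ ε := by rwa [hμ k]
    have happrox' (k : ℤ) : ∫⁻ x, ‖K (x + v) - f (tauZ d k (x + v))‖ₑ ∂μ ≤ D * ε := by
      calc ∫⁻ x, ‖K (x + v) - f (tauZ d k (x + v))‖ₑ ∂μ
          = ∫⁻ y, ‖K y - f (tauZ d k y)‖ₑ ∂(μ.map fun x => x + v) :=
            (lintegral_map (hKm.sub (hfm.comp (hτ k))).enorm (hadd v)).symm
        _ ≤ ∫⁻ y, ‖K y - f (tauZ d k y)‖ₑ ∂(D • μ) := lintegral_mono' hquasi le_rfl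
        _ = D * ∫⁻ y, ‖K y - f (tauZ d k y)‖ₑ ∂μ := lintegral_smul_measure _ _
        _ ≤ D * ε := by gcongr; exact happrox k
    have hcont : Tendsto (fun k : ℕ => ∫⁻ y, ‖f (y + tauZ d k v) - f y‖ₑ ∂μ) atTop
        (nhds 0) := by
      have hlim : Tendsto (fun k : ℕ => ∫⁻ y, ‖f (y + tauZ d k v) - f y‖ₑ ∂μ) atTop
          (nhds (∫⁻ _, 0 ∂μ)) := by
        refine tendsto_lintegral_of_dominated_convergence
          (fun _ => ENNReal.ofReal (‖f‖ + ‖f‖)) (fun k => ?_) (fun k => ?_) ?_ ?_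
        · exact ((hfm.comp (hadd _)).sub hfm).enorm
        · refine ae_of_all _ fun y => ?_
          beta_reduce
          rw [← ofReal_norm]
          exact ENNReal.ofReal_le_ofReal ((norm_sub_le _ _).trans
            (add_le_add (f.norm_coe_le_norm _) (f.norm_coe_le_norm _)))
        · rw [lintegral_const]
          exact ENNReal.mul_ne_top ENNReal.ofReal_ne_top (measure_ne_top μ _)
        · refine ae_of_all _ fun y => ?_
          have h1 : Tendsto (fun k : ℕ => y + tauZ d k v) atTop (nhds y) := by
            simpa using tendsto_const_nhds.add hv.tendsto_tauZ
          have h2 := (((f.continuous.tendsto y).comp h1).sub_const (f y)).enorm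
          simpa using h2
      simpa using hlim
    have hsplit (k : ℕ) : ∫⁻ x, ‖K (x + v) - K x‖ₑ ∂μ
        ≤ (D + 1) * ε + ∫⁻ y, ‖f (y + tauZ d k v) - f y‖ₑ ∂μ := by
      calc ∫⁻ x, ‖K (x + v) - K x‖ₑ ∂μ
          ≤ ∫⁻ x, (‖K (x + v) - f (tauZ d k (x + v))‖ₑ + ‖K x - f (tauZ d k x)‖ₑ
              + ‖f (tauZ d k x + tauZ d k v) - f (tauZ d k x)‖ₑ) ∂μ := by
            refine lintegral_mono fun x => ?_
            rw [← enorm_neg (K x - f (tauZ d k x)), ← tauZ_add]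
            refine le_trans (le_of_eq ?_) ((enorm_add_le _ _).trans
              (add_le_add_left (enorm_add_le _ _) _))
            congr 1
            ring
        _ = ∫⁻ x, ‖K (x + v) - f (tauZ d k (x + v))‖ₑ ∂μ
              + ∫⁻ x, ‖K x - f (tauZ d k x)‖ₑ ∂μ
              + ∫⁻ x, ‖f (tauZ d k x + tauZ d k v) - f (tauZ d k x)‖ₑ ∂μ := by
            have hm : Measurable fun x => ‖K x - f (tauZ d k x)‖ₑ :=
              (hKm.sub (hfm.comp (hτ k))).enorm
            have hm' : Measurable fun x => ‖K (x + v) - f (tauZ d k (x + v))‖ₑ :=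
              hm.comp (hadd v)
            rw [← lintegral_add_left hm', ← lintegral_add_left]
            exact hm'.add hm
        _ ≤ D * ε + ε + ∫⁻ y, ‖f (y + tauZ d k v) - f y‖ₑ ∂(μ.map (tauZ d k)) := by
            have hm : Measurable fun y => ‖f (y + tauZ d k v) - f y‖ₑ :=
              ((hfm.comp (hadd _)).sub hfm).enorm
            rw [lintegral_map hm (hτ k)]
            exact add_le_add_left (add_le_add (happrox' k) (happrox k)) _
        _ = _ := by rw [hμ, add_mul, one_mul]
    have hlim := hcont.const_add ((D + 1) * ε)
    rw [add_zero] at hlim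
    exact ge_of_tendsto' hlim hsplit
  have hzero : ∫⁻ x, ‖K (x + v) - K x‖ₑ ∂μ = 0 := by
    have hlim : Tendsto (fun ε : ℝ≥0∞ => (D + 1) * ε) (nhdsWithin 0 (Set.Ioi 0)) (nhds 0) := by
      have h := ENNReal.Tendsto.const_mul (a := D + 1) (tendsto_id (x := nhds (0 : ℝ≥0∞)))
        (Or.inr (by finiteness))
      simp only [mul_zero, id] at h
      exact h.mono_left nhdsWithin_le_nhds
    refine le_antisymm (ge_of_tendsto hlim ?_) bot_le
    filter_upwards [self_mem_nhdsWithin] with ε hε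
    exact hbound ε (ne_of_gt hε)
  have hm : Measurable fun x => ‖K (x + v) - K x‖ₑ := ((hKm.comp (hadd v)).sub hKm).enorm
  rw [lintegral_eq_zero_iff hm] at hzero
  filter_upwards [hzero] with x hx
  simpa [sub_eq_zero] using hx

lemma HolderPotential.map_add_le (hU : HolderPotential d U) (hv : Homoclinic d v 0)
    {μ : Measure (Omega d)} (hμ : ∀ u, Homoclinic d u 0 → gibbsTransport d U u μ = μ) :
    ∃ D : ℝ≥0∞, D ≠ ∞ ∧ (μ.map fun x => x + v) ≤ D • μ := by
  obtain ⟨L, hL⟩ := isCompact_univ.exists_bound_of_continuousOn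
    (hU.continuous_energy hv.neg).continuousOn
  refine ⟨ENNReal.ofReal (Real.exp L), ENNReal.ofReal_ne_top, ?_⟩
  have hle : ENNReal.ofReal (Real.exp (-L)) • (μ.map fun x => x - -v) ≤ μ := by
    conv_rhs => rw [← hμ (-v) hv.neg]
    rw [gibbsTransport, ← withDensity_const]
    refine withDensity_mono (ae_of_all _ fun x => ?_)
    refine ENNReal.ofReal_le_ofReal (Real.exp_le_exp.2 (neg_le_neg ?_))
    exact (le_abs_self _).trans (hL x (Set.mem_univ x))
  simp only [sub_neg_eq_add] at hle
  refine Measure.le_iff'.2 fun s => ?_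
  have hs := mul_le_mul_right (hle s) (ENNReal.ofReal (Real.exp L))
  rwa [Measure.smul_apply, smul_eq_mul, ← mul_assoc, ← ENNReal.ofReal_mul (Real.exp_pos _).le,
    ← Real.exp_add, add_neg_cancel, Real.exp_zero, ENNReal.ofReal_one, one_mul] at hs

/-- An equilibrium probability is fixed by all the weighted translations. -/
theorem IsEquilibrium.gibbsTransport_eq {ρ : Measure (Omega d)} [IsFiniteMeasure ρ]
    (h : IsEquilibrium d U ρ) (hU : HolderPotential d U) (hv : Homoclinic d v 0) :
    gibbsTransport d U v ρ = ρ := by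
  obtain ⟨C, hC⟩ := h.exists_gibbsTransport_le hU
  have hρ := map_tauZ_eq h.1
  set μ := gibbsHull d U ρ
  have hμfin : IsFiniteMeasure μ := by
    have := Measure.smul_finite ρ (ENNReal.ofReal_ne_top (r := C))
    exact isFiniteMeasure_of_le _ (iSup₂_le hC : μ ≤ ENNReal.ofReal C • ρ)
  have hμτ : ∀ k, μ.map (tauZ d k) = μ := map_tauZ_gibbsHull hρ
  have hμ : ∀ u, Homoclinic d u 0 → gibbsTransport d U u μ = μ :=
    fun u hu => hU.gibbsTransport_gibbsHull hu
  have hac : ρ ≪ μ := le_gibbsHull.absolutelyContinuous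
  let r := ρ.rnDeriv μ
  have hrm : Measurable r := Measure.measurable_rnDeriv ρ μ
  have : SigmaFinite μ := inferInstance
  have hr : μ.withDensity r = ρ := Measure.withDensity_rnDeriv_eq _ _ hac
  let K : Omega d → ℝ := fun x => (r x).toReal
  have hK (k : ℤ) : K ∘ tauZ d k =ᵐ[μ] K := by
    have hmap := map_homeomorph_withDensity (shiftHomeo d (-k)) μ r
    have hsymm : ((shiftHomeo d (-k)).symm : Omega d → Omega d) = tauZ d k := by
      funext x
      change tauZ d (- -k) x = _
      rw [neg_neg]
    have hcoe : (shiftHomeo d (-k) : Omega d → Omega d) = tauZ d (-k) := rfl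
    rw [hcoe, hsymm, hμτ, hr, hρ, ← hr] at hmap
    have hτ : Measurable (tauZ d k) := (continuous_tauZ k).measurable
    have := (withDensity_eq_iff_of_sigmaFinite hrm.aemeasurable
      (hrm.comp hτ).aemeasurable).1 hmap
    filter_upwards [this] with x hx
    simp only [K, Function.comp_apply] at hx ⊢
    rw [hx]
  obtain ⟨D, hD, hquasi⟩ := hU.map_add_le hv hμ
  have hKv := ae_add_eq_of_shift_invariant hμτ hrm.ennreal_toReal
    Measure.integrable_toReal_rnDeriv hK hv hD hquasi
  let q : Omega d → ℝ≥0∞ := fun x => ENNReal.ofReal (K x)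
  have hqm : Measurable q := hrm.ennreal_toReal.ennreal_ofReal
  have hq : μ.withDensity q = ρ := by
    rw [← hr]
    refine withDensity_congr_ae ?_
    filter_upwards [Measure.rnDeriv_lt_top ρ μ] with x hx
    exact ENNReal.ofReal_toReal hx.ne
  have hqv : Measurable fun x => q (x + v) := hqm.comp (continuous_add_const v).measurable
  have hmap : (μ.withDensity q).map (fun x => x - v)
      = (μ.map fun x => x - v).withDensity fun x => q (x + v) :=
    map_homeomorph_withDensity (Homeomorph.subRight v) μ q
  have hdens := hU.measurable_density hv
  calc gibbsTransport d U v ρ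
      = ((μ.map fun x => x - v).withDensity fun x => q (x + v)).withDensity
          fun x => ENNReal.ofReal (Real.exp (-energy d U v x)) := by
        rw [← hmap, hq, gibbsTransport]
    _ = (gibbsTransport d U v μ).withDensity fun x => q (x + v) := by
        rw [gibbsTransport, ← withDensity_mul _ hqv hdens, ← withDensity_mul _ hdens hqv, mul_comm]
    _ = μ.withDensity q := by
        rw [hμ v hv]
        refine withDensity_congr_ae ?_
        filter_upwards [hKv] with x hx
        exact congrArg ENNReal.ofReal hx
    _ = ρ := hq

end Invariance

/-- The equilibrium probability of a Hölder potential `B` is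
C*-Gibbs for `B`, for every (possibly non-symmetric) conjugating homeomorphism. -/
theorem equilibrium_implies_cstarGibbs (d : ℕ) (hd : 2 ≤ d) (B : Omega d → ℝ)
    (hB : HolderPotential d B) (ρ : Measure (Omega d)) (hρ : IsProbabilityMeasure ρ)
    (heq : IsEquilibrium d B ρ)
    (n m : ℕ) (hn : 1 ≤ n) (hm : 1 ≤ m) (a b : ℤ → Fin d)
    (g : Omega d → ℂ) (hg : Continuous g) :
    ∫ z in cyl d n m b, g z ∂ρ
      = ∫ z in cyl d n m a,
          (Real.exp (-(Vfun d B z (conjMap d n m b z))) : ℂ) * g (conjMap d n m b z) ∂ρ := by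
  have : NeZero d := ⟨by omega⟩
  let v : Omega d := fun j => if -(n : ℤ) ≤ j ∧ j ≤ (m : ℤ) then b j - a j else 0
  have hv : Homoclinic d v 0 := by
    refine (Set.finite_Icc (-(n : ℤ)) m).subset fun j hj => ?_
    by_contra hj'
    exact hj (if_neg hj')
  have hconj : ∀ z ∈ cyl d n m a, conjMap d n m b z = z + v := by
    intro z hz
    funext j
    by_cases hj : -(n : ℤ) ≤ j ∧ j ≤ (m : ℤ)
    · simp [conjMap, v, hj, hz j hj.1 hj.2]
    · simp [conjMap, v, hj]
  have hpre : (fun z : Omega d => z - v) ⁻¹' cyl d n m a = cyl d n m b := by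
    ext z
    refine forall_congr' fun j => forall_congr' fun h1 => forall_congr' fun h2 => ?_
    simp only [Pi.sub_apply, v, h1, h2, and_self, if_true]
    rw [sub_eq_iff_eq_add, add_sub_cancel]
  have hfix := heq.gibbsTransport_eq hB hv
  symm
  calc _ = ∫ z in cyl d n m a, (Real.exp (energy d B v z) : ℂ) * g (z + v) ∂ρ :=
        setIntegral_congr_fun (measurableSet_cyl n m a) fun z hz => by
          simp only [hconj z hz, Vfun_add_right, neg_neg]
    _ = ∫ z in cyl d n m a, (Real.exp (energy d B v z) : ℂ) * g (z + v)
          ∂(gibbsTransport d B v ρ) := by rw [hfix]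
    _ = ∫ z in cyl d n m a, g (z + v) ∂(ρ.map fun z => z - v) := by
        rw [gibbsTransport, setIntegral_withDensity_eq_setIntegral_toReal_smul
          (hB.measurable_density hv) (ae_of_all _ fun _ => ENNReal.ofReal_lt_top) _
          (measurableSet_cyl n m a)]
        refine setIntegral_congr_fun (measurableSet_cyl n m a) fun z _ => ?_
        rw [ENNReal.toReal_ofReal (Real.exp_pos _).le, Complex.real_smul, ← mul_assoc,
          ← Complex.ofReal_mul, ← Real.exp_add, neg_add_cancel, Real.exp_zero,
          Complex.ofReal_one, one_mul]
    _ = ∫ z in cyl d n m b, g z ∂ρ := by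
        have h := (Homeomorph.subRight v).measurableEmbedding.setIntegral_map
          (μ := ρ) (fun z => g (z + v)) (cyl d n m a)
        rw [Homeomorph.coe_subRight, hpre] at h
        simpa using h
end
end

section
/- Let r ≥ 1, f : {1,…,d}^r → ℝ, and let U : Ω → ℝ be the potential U(x) = f(x₁,…,x_r) (depending only on the coordinates x₁,…,x_r). If α is a C*-Gibbs probability measure for U (at β = 1), then α is the equilibrium (Gibbs) probability for U. -/
open MeasureTheory Filter
open scoped ENNReal

noncomputable section

/-- `U x` depends only on the coordinates `x₁, …, x_r`. -/
def DependsOnFirst (d r : ℕ) (U : Omega d → ℝ) : Prop :=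
  ∀ x y : Omega d, (∀ j : ℤ, 1 ≤ j → j ≤ r → x j = y j) → U x = U y

/-- The cylinder of points agreeing with `x` on the integer interval `[A, B]`. -/
def intervalCyl (d : ℕ) (A B : ℤ) (x : Omega d) : Set (Omega d) :=
  {z | ∀ j : ℤ, A ≤ j → j ≤ B → z j = x j}

/-- The point equal to `x` on `[A, B]` and to `y` elsewhere. -/
def splice (d : ℕ) (A B : ℤ) (x y : Omega d) : Omega d :=
  fun j => if A ≤ j ∧ j ≤ B then x j else y j

theorem abs_sum_le_mul_card {ι : Type*} [DecidableEq ι] (T S : Finset ι) (g : ι → ℝ) {K : ℝ}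
    (hK : 0 ≤ K) (hg : ∀ k ∈ T, |g k| ≤ K) (h0 : ∀ k ∈ T, k ∉ S → g k = 0) :
    |∑ k ∈ T, g k| ≤ K * S.card := by
  have h1 : ∑ k ∈ T, g k = ∑ k ∈ T ∩ S, g k := by
    refine (Finset.sum_subset Finset.inter_subset_left fun k hk hk' => h0 k hk ?_).symm
    exact fun h => hk' (Finset.mem_inter.2 ⟨hk, h⟩)
  rw [h1]
  calc |∑ k ∈ T ∩ S, g k| ≤ ∑ k ∈ T ∩ S, |g k| := Finset.abs_sum_le_sum_abs _ _
    _ ≤ ∑ k ∈ T ∩ S, K := Finset.sum_le_sum fun k hk => hg k (Finset.mem_inter.1 hk).1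
    _ = K * (T ∩ S).card := by rw [Finset.sum_const, nsmul_eq_mul, mul_comm]
    _ ≤ K * S.card := by gcongr; exact Finset.inter_subset_right

section Energy

variable {d r : ℕ} {U : Omega d → ℝ} {M : ℝ}

theorem DependsOnFirst.tauZ_eq (hU : DependsOnFirst d r U) {k : ℤ} {x y : Omega d}
    (h : ∀ j : ℤ, k + 1 ≤ j → j ≤ k + r → x j = y j) : U (tauZ d k x) = U (tauZ d k y) :=
  hU _ _ fun j h1 h2 => h _ (by omega) (by omega)

theorem Vfun_swap (x y : Omega d) : Vfun d U y x = -Vfun d U x y := by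
  unfold Vfun
  rw [← tsum_neg]
  exact tsum_congr fun k => by ring

theorem Vfun_shift (x y : Omega d) (n : ℤ) :
    Vfun d U (tauZ d n x) (tauZ d n y) = Vfun d U x y := by
  unfold Vfun
  rw [← (Equiv.addRight n).tsum_eq fun k => U (tauZ d k x) - U (tauZ d k y)]
  refine tsum_congr fun k => ?_
  have h : ∀ z : Omega d, tauZ d k (tauZ d n z) = tauZ d (k + n) z := fun z => by
    funext j
    simp only [tauZ]
    congr 1
    ring
  simp [h]

/-- Only the coordinates in `[A, B]` matter for `V x y` when `x` and `y` agree outside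
`[A + r, B - r]`. -/
theorem DependsOnFirst.Vfun_congr (hU : DependsOnFirst d r U) {A B : ℤ} {x y x' y' : Omega d}
    (hxy : ∀ j, x j ≠ y j → A + r ≤ j ∧ j ≤ B - r)
    (hxy' : ∀ j, x' j ≠ y' j → A + r ≤ j ∧ j ≤ B - r)
    (hx : ∀ j, A ≤ j → j ≤ B → x j = x' j) (hy : ∀ j, A ≤ j → j ≤ B → y j = y' j) :
    Vfun d U x y = Vfun d U x' y' := by
  unfold Vfun
  refine tsum_congr fun k => ?_
  by_cases hk : A ≤ k + 1 ∧ k + r ≤ B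
  · rw [hU.tauZ_eq (x := x) (y := x') fun j h1 h2 => hx j (by omega) (by omega),
      hU.tauZ_eq (x := y) (y := y') fun j h1 h2 => hy j (by omega) (by omega)]
  · rw [hU.tauZ_eq (x := x) (y := y), hU.tauZ_eq (x := x') (y := y'), sub_self, sub_self]
    · intro j h1 h2
      by_contra h
      have := hxy' j h
      omega
    · intro j h1 h2
      by_contra h
      have := hxy j h
      omega

theorem DependsOnFirst.Vfun_eq_sum (hU : DependsOnFirst d r U) {A B : ℤ} {x y : Omega d}
    (hxy : ∀ j, x j ≠ y j → A ≤ j ∧ j ≤ B) :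
    Vfun d U x y = ∑ k ∈ Finset.Ico (A - r - 1) B, (U (tauZ d k x) - U (tauZ d k y)) := by
  unfold Vfun
  refine tsum_eq_sum fun k hk => ?_
  rw [Finset.mem_Ico] at hk
  rw [hU.tauZ_eq (x := x) (y := y), sub_self]
  intro j h1 h2
  by_contra h
  have := hxy j h
  omega

/-- Changing the common exterior of two configurations changes their relative energy by a bounded
amount. -/
theorem DependsOnFirst.abs_Vfun_sub_le (hU : DependsOnFirst d r U) (hM : ∀ x, |U x| ≤ M)
    {A B : ℤ} {x y x' y' : Omega d}
    (hxy : ∀ j, x j ≠ y j → A ≤ j ∧ j ≤ B)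
    (hxy' : ∀ j, x' j ≠ y' j → A ≤ j ∧ j ≤ B)
    (hx : ∀ j, A ≤ j → j ≤ B → x j = x' j) (hy : ∀ j, A ≤ j → j ≤ B → y j = y' j) :
    |Vfun d U x y - Vfun d U x' y'| ≤ 4 * M * (2 * (r + 1)) := by
  have hM0 : 0 ≤ M := (abs_nonneg _).trans (hM x)
  rw [hU.Vfun_eq_sum hxy, hU.Vfun_eq_sum hxy', ← Finset.sum_sub_distrib]
  have hcard : ((Finset.Ico (A - r - 1) A ∪ Finset.Ico (B - r) (B + 1)).card : ℝ)
      ≤ 2 * (r + 1) := by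
    have h : (Finset.Ico (A - r - 1) A ∪ Finset.Ico (B - r) (B + 1)).card ≤ 2 * (r + 1) := by
      refine (Finset.card_union_le _ _).trans ?_
      simp only [Int.card_Ico]
      omega
    exact_mod_cast h
  refine (abs_sum_le_mul_card _ (Finset.Ico (A - r - 1) A ∪ Finset.Ico (B - r) (B + 1)) _
    (K := 4 * M) (by positivity) (fun k _ => ?_) fun k _ hk => ?_).trans
    (mul_le_mul_of_nonneg_left hcard (by positivity))
  · have h1 := abs_le.1 (hM (tauZ d k x))
    have h2 := abs_le.1 (hM (tauZ d k y))
    have h3 := abs_le.1 (hM (tauZ d k x'))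
    have h4 := abs_le.1 (hM (tauZ d k y'))
    rw [abs_le]
    constructor <;> linarith
  · simp only [Finset.mem_union, Finset.mem_Ico, not_or] at hk
    by_cases hk' : A ≤ k + 1 ∧ k + r ≤ B
    · rw [hU.tauZ_eq (x := x) (y := x') fun j h1 h2 => hx j (by omega) (by omega),
        hU.tauZ_eq (x := y) (y := y') fun j h1 h2 => hy j (by omega) (by omega), sub_self]
    · rw [hU.tauZ_eq (x := x) (y := y), hU.tauZ_eq (x := x') (y := y'), sub_self, sub_self,
        sub_self]
      · intro j h1 h2
        by_contra h
        have := hxy' j h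
        omega
      · intro j h1 h2
        by_contra h
        have := hxy j h
        omega

theorem DependsOnFirst.abs_birkhoff_sub_le (hU : DependsOnFirst d r U) (hM : ∀ x, |U x| ≤ M)
    {s : ℕ} {x y : Omega d} (hxy : ∀ j : ℤ, 1 ≤ j → j ≤ s → x j = y j) :
    |birkhoff d U s x - birkhoff d U s y| ≤ 2 * M * r := by
  have hM0 : 0 ≤ M := (abs_nonneg _).trans (hM x)
  unfold birkhoff
  rw [← Finset.sum_sub_distrib]
  have hcard : ((Finset.Ico (s - r) s).card : ℝ) ≤ r := by
    have h : (Finset.Ico (s - r) s).card ≤ r := by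
      rw [Nat.card_Ico]
      omega
    exact_mod_cast h
  refine (abs_sum_le_mul_card _ (Finset.Ico (s - r) s) _
    (K := 2 * M) (by positivity) (fun k _ => ?_) fun k hk hk' => ?_).trans
    (mul_le_mul_of_nonneg_left hcard (by positivity))
  · have h1 := abs_le.1 (hM (tauZ d k x))
    have h2 := abs_le.1 (hM (tauZ d k y))
    rw [abs_le]
    constructor <;> linarith
  · rw [Finset.mem_Ico] at hk'
    rw [Finset.mem_range] at hk
    rw [hU.tauZ_eq (x := x) (y := y) fun j h1 h2 => hxy j (by omega) (by omega), sub_self]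

theorem birkhoff_add (s t : ℕ) (x : Omega d) :
    birkhoff d U (s + t) x = birkhoff d U s x + birkhoff d U t (tauZ d s x) := by
  unfold birkhoff
  rw [Finset.sum_range_add]
  congr 1
  refine Finset.sum_congr rfl fun k _ => ?_
  congr 1
  funext j
  simp only [tauZ]
  congr 1
  push_cast
  ring

theorem DependsOnFirst.abs_Vfun_sub_birkhoff_le (hU : DependsOnFirst d r U)
    (hM : ∀ x, |U x| ≤ M) {s : ℕ} {x y : Omega d}
    (hxy : ∀ j, x j ≠ y j → 1 ≤ j ∧ j ≤ s) :
    |Vfun d U x y - (birkhoff d U s x - birkhoff d U s y)| ≤ 2 * M * r := by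
  have hM0 : 0 ≤ M := (abs_nonneg _).trans (hM x)
  rw [hU.Vfun_eq_sum hxy]
  have h1 : birkhoff d U s x - birkhoff d U s y
      = ∑ k ∈ Finset.Ico (0 : ℤ) s, (U (tauZ d k x) - U (tauZ d k y)) := by
    unfold birkhoff
    rw [← Finset.sum_sub_distrib]
    refine Finset.sum_bij (fun k _ => (k : ℤ)) (fun k hk => ?_) (fun a _ b _ h => ?_)
      (fun b hb => ?_) fun k _ => rfl
    · rw [Finset.mem_range] at hk
      rw [Finset.mem_Ico]
      omega
    · exact_mod_cast h
    · rw [Finset.mem_Ico] at hb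
      exact ⟨b.toNat, by rw [Finset.mem_range]; omega, by omega⟩
  rw [h1, ← Finset.sum_sdiff (Finset.Ico_subset_Ico_left (show (1 - r - 1 : ℤ) ≤ 0 by omega)),
    add_sub_cancel_right]
  have hcard : ((Finset.Ico (1 - r - 1 : ℤ) 0).card : ℝ) ≤ r := by
    have h : (Finset.Ico (1 - r - 1 : ℤ) 0).card ≤ r := by
      rw [Int.card_Ico]
      omega
    exact_mod_cast h
  refine (abs_sum_le_mul_card _ (Finset.Ico (1 - r - 1 : ℤ) 0) _
    (K := 2 * M) (by positivity) (fun k _ => ?_) fun k hk hk' => absurd ?_ hk').trans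
    (mul_le_mul_of_nonneg_left hcard (by positivity))
  swap
  · rw [Finset.mem_sdiff, Finset.mem_Ico, Finset.mem_Ico] at hk
    rw [Finset.mem_Ico]
    omega
  have h1 := abs_le.1 (hM (tauZ d k x))
  have h2 := abs_le.1 (hM (tauZ d k y))
  rw [abs_le]
  constructor <;> linarith

end Energy

/-- A consistent family of cylinder weights on integer intervals satisfying the finite-volume Gibbs
relations for `U`. -/
structure IsGibbsWeight (d r : ℕ) (U : Omega d → ℝ) (p : ℤ → ℤ → Omega d → ℝ) : Prop where
  nonneg : ∀ A B x, A ≤ B + 1 → 0 ≤ p A B x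
  congr : ∀ A B x y, (∀ j, A ≤ j → j ≤ B → x j = y j) → p A B x = p A B y
  empty : ∀ B x, p (B + 1) B x = 1
  right : ∀ A B x, A ≤ B + 1 → p A B x = ∑ s, p A (B + 1) (Function.update x (B + 1) s)
  left : ∀ A B x, A ≤ B + 1 → p A B x = ∑ s, p (A - 1) B (Function.update x (A - 1) s)
  gibbs : ∀ (A B : ℤ) x y, A ≤ B + 1 → (∀ j, x j ≠ y j → A + r ≤ j ∧ j ≤ B - r) →
    p A B x * Real.exp (-Vfun d U x y) = p A B y

theorem interval_descent {R : ℤ → ℤ → Prop} {A₀ B₀ : ℤ}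
    (hr : ∀ A B, A ≤ A₀ → B₀ ≤ B → R A (B + 1) → R A B)
    (hl : ∀ A B, A ≤ A₀ → B₀ ≤ B → R (A - 1) B → R A B) (m n : ℕ)
    (h : R (A₀ - m) (B₀ + n)) : R A₀ B₀ := by
  induction n with
  | zero =>
    induction m with
    | zero => simpa using h
    | succ m ih =>
      refine ih (hl _ _ (by omega) (by omega) ?_)
      convert h using 1
      push_cast
      ring
  | succ n ih =>
    refine ih (hr _ _ (by omega) (by omega) ?_)
    convert h using 1
    push_cast
    ring

namespace IsGibbsWeight

variable {d r : ℕ} {U : Omega d → ℝ} {M : ℝ} {p q : ℤ → ℤ → Omega d → ℝ}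

/-- Two configurations differing only in `[A, B]` have comparable weights. -/
theorem le_exp_mul (hU : DependsOnFirst d r U) (hM : ∀ x, |U x| ≤ M) (hp : IsGibbsWeight d r U p)
    {A B : ℤ} (hAB : A ≤ B + 1) {x y : Omega d} (hxy : ∀ j, x j ≠ y j → A ≤ j ∧ j ≤ B) :
    p A B x ≤ Real.exp (Vfun d U x y + 4 * M * (2 * (r + 1))) * p A B y := by
  set K := Real.exp (Vfun d U x y + 4 * M * (2 * (r + 1))) with hK
  let R : ℤ → ℤ → Prop := fun A' B' => ∀ x' y' : Omega d,
    (∀ j, x' j ≠ y' j → A ≤ j ∧ j ≤ B) → (∀ j, A ≤ j → j ≤ B → x j = x' j) →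
    (∀ j, A ≤ j → j ≤ B → y j = y' j) → p A' B' x' ≤ K * p A' B' y'
  have hR : R A B := by
    refine interval_descent (R := R) (fun A' B' hA hB h x' y' h1 h2 h3 => ?_)
      (fun A' B' hA hB h x' y' h1 h2 h3 => ?_) r r fun x' y' h1 h2 h3 => ?_
    · rw [hp.right A' B' x' (by omega), hp.right A' B' y' (by omega), Finset.mul_sum]
      refine Finset.sum_le_sum fun s _ => h _ _ (fun j hj => ?_) (fun j hj hj' => ?_)
        fun j hj hj' => ?_
      · by_cases hjB : j = B' + 1
        · simp [hjB] at hj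
        · exact h1 j (by simpa [hjB] using hj)
      · rw [Function.update_of_ne (by omega)]; exact h2 j hj hj'
      · rw [Function.update_of_ne (by omega)]; exact h3 j hj hj'
    · rw [hp.left A' B' x' (by omega), hp.left A' B' y' (by omega), Finset.mul_sum]
      refine Finset.sum_le_sum fun s _ => h _ _ (fun j hj => ?_) (fun j hj hj' => ?_)
        fun j hj hj' => ?_
      · by_cases hjB : j = A' - 1
        · simp [hjB] at hj
        · exact h1 j (by simpa [hjB] using hj)
      · rw [Function.update_of_ne (by omega)]; exact h2 j hj hj'
      · rw [Function.update_of_ne (by omega)]; exact h3 j hj hj'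
    · have hg := hp.gibbs (A - r) (B + r) y' x' (by omega) fun j hj => by
        have := h1 j hj.symm
        omega
      rw [← hg, mul_comm]
      refine mul_le_mul_of_nonneg_right ?_ (hp.nonneg _ _ _ (by omega))
      rw [hK, Real.exp_le_exp, Vfun_swap x' y', neg_neg]
      have := abs_le.1 (hU.abs_Vfun_sub_le hM hxy h1 h2 h3)
      linarith
  exact hR x y hxy (fun _ _ _ => rfl) fun _ _ _ => rfl

theorem mul_le_mul_swap (hU : DependsOnFirst d r U) (hM : ∀ x, |U x| ≤ M)
    (hp : IsGibbsWeight d r U p) (hq : IsGibbsWeight d r U q)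
    {A B : ℤ} (hAB : A ≤ B + 1) (x y : Omega d) :
    p A B x * q A B y ≤ Real.exp (2 * (4 * M * (2 * (r + 1)))) * (p A B y * q A B x) := by
  have hy : ∀ j, A ≤ j → j ≤ B → y j = splice d A B y x j := fun j h1 h2 => by
    simp [splice, h1, h2]
  have hx : ∀ j, x j ≠ splice d A B y x j → A ≤ j ∧ j ≤ B := fun j hj => by
    by_contra h
    simp [splice, h] at hj
  rw [hp.congr A B y _ hy, hq.congr A B y _ hy]
  have h1 := hp.le_exp_mul hU hM hAB hx
  have h2 := hq.le_exp_mul hU hM hAB fun j hj => hx j hj.symm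
  refine (mul_le_mul h1 h2 (hq.nonneg _ _ _ hAB)
    (mul_nonneg (Real.exp_nonneg _) (hp.nonneg _ _ _ hAB))).trans (le_of_eq ?_)
  rw [Vfun_swap x, mul_mul_mul_comm, ← Real.exp_add]
  congr 2
  ring

/-- Any two Gibbs weights are comparable with a constant depending only on the potential. -/
theorem le_exp_mul_other (hU : DependsOnFirst d r U) (hM : ∀ x, |U x| ≤ M)
    (hp : IsGibbsWeight d r U p) (hq : IsGibbsWeight d r U q)
    {A B : ℤ} (hAB : A ≤ B + 1) (x : Omega d) :
    p A B x ≤ Real.exp (2 * (4 * M * (2 * (r + 1)))) * q A B x := by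
  set K := Real.exp (2 * (4 * M * (2 * (r + 1))))
  let R : ℤ → ℤ → Prop := fun A' B' => ∀ y : Omega d,
    p A B x * q A' B' y ≤ K * q A B x * p A' B' y
  have hR : R (B + 1) B := by
    refine interval_descent (R := R) (fun A' B' hA hB h y => ?_)
      (fun A' B' hA hB h y => ?_) (B + 1 - A).toNat 0 fun y => ?_
    · rw [hp.right A' B' y (by omega), hq.right A' B' y (by omega), Finset.mul_sum,
        Finset.mul_sum]
      exact Finset.sum_le_sum fun s _ => h _
    · rw [hp.left A' B' y (by omega), hq.left A' B' y (by omega), Finset.mul_sum,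
        Finset.mul_sum]
      exact Finset.sum_le_sum fun s _ => h _
    · rw [show B + 1 - ((B + 1 - A).toNat : ℤ) = A by omega, Nat.cast_zero, add_zero]
      refine (hp.mul_le_mul_swap hU hM hq hAB x y).trans (le_of_eq ?_)
      ring
  simpa [hp.empty, hq.empty] using hR x

theorem sub_smul (hp : IsGibbsWeight d r U p) (hq : IsGibbsWeight d r U q) {c : ℝ} (hc : c < 1)
    (h : ∀ A B x, A ≤ B + 1 → c * p A B x ≤ q A B x) :
    IsGibbsWeight d r U fun A B x => (q A B x - c * p A B x) / (1 - c) where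
  nonneg A B x hAB := div_nonneg (sub_nonneg.2 (h A B x hAB)) (by linarith)
  congr A B x y hxy := by rw [hp.congr A B x y hxy, hq.congr A B x y hxy]
  empty B x := by
    rw [hp.empty, hq.empty, mul_one, div_self]
    linarith
  right A B x hAB := by
    rw [← Finset.sum_div, Finset.sum_sub_distrib, ← Finset.mul_sum, ← hp.right A B x hAB,
      ← hq.right A B x hAB]
  left A B x hAB := by
    rw [← Finset.sum_div, Finset.sum_sub_distrib, ← Finset.mul_sum, ← hp.left A B x hAB,
      ← hq.left A B x hAB]
  gibbs A B x y hAB hxy := by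
    rw [← hp.gibbs A B x y hAB hxy, ← hq.gibbs A B x y hAB hxy]
    ring

theorem one_sub_pow_mul_le (hU : DependsOnFirst d r U) (hM : ∀ x, |U x| ≤ M) {δ : ℝ}
    (hδ : 0 < δ) (hδK : (1 - δ) * Real.exp (2 * (4 * M * (2 * (r + 1)))) ≤ 1) (hδ1 : δ < 1)
    (n : ℕ) : ∀ {p q : ℤ → ℤ → Omega d → ℝ}, IsGibbsWeight d r U p → IsGibbsWeight d r U q →
      ∀ A B x, A ≤ B + 1 → (1 - δ ^ n) * p A B x ≤ q A B x := by
  induction n with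
  | zero =>
    intro p q _ hq A B x hAB
    simpa using hq.nonneg A B x hAB
  | succ n ih =>
    intro p q hp hq A B x hAB
    have hn : 0 < δ ^ n := pow_pos hδ n
    have hs := hp.sub_smul hq (c := 1 - δ ^ n) (by linarith) (ih hp hq)
    have h := hp.le_exp_mul_other hU hM hs hAB x
    simp only [sub_sub_cancel] at h
    have hs0 := hs.nonneg A B x hAB
    simp only [sub_sub_cancel] at hs0
    set t := (q A B x - (1 - δ ^ n) * p A B x) / δ ^ n with ht
    have hq' : q A B x = t * δ ^ n + (1 - δ ^ n) * p A B x := by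
      rw [ht, div_mul_cancel₀ _ hn.ne']
      ring
    have h2 : (1 - δ) * p A B x ≤ t := by
      refine (mul_le_mul_of_nonneg_left h (by linarith)).trans ?_
      rw [← mul_assoc]
      exact mul_le_of_le_one_left hs0 hδK
    rw [hq', pow_succ]
    nlinarith [mul_le_mul_of_nonneg_left h2 hn.le]

theorem le_other (hU : DependsOnFirst d r U) (hM : ∀ x, |U x| ≤ M)
    (hp : IsGibbsWeight d r U p) (hq : IsGibbsWeight d r U q)
    {A B : ℤ} (hAB : A ≤ B + 1) (x : Omega d) : p A B x ≤ q A B x := by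
  have hM0 : 0 ≤ M := (abs_nonneg _).trans (hM x)
  set K := 2 * (4 * M * (2 * ((r : ℝ) + 1))) with hK
  have hK0 : 0 ≤ K := by positivity
  have h1 : Real.exp (-(K + 1)) < 1 := Real.exp_lt_one_iff.2 (by linarith)
  have hδ : 0 < 1 - Real.exp (-(K + 1)) := by linarith
  have hδ1 : 1 - Real.exp (-(K + 1)) < 1 := by linarith [Real.exp_pos (-(K + 1))]
  have hlim := ((tendsto_pow_atTop_nhds_zero_of_lt_one hδ.le hδ1).const_sub 1).mul_const (p A B x)
  rw [sub_zero, one_mul] at hlim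
  refine le_of_tendsto' hlim fun n => one_sub_pow_mul_le hU hM hδ ?_ hδ1 n hp hq A B x hAB
  rw [sub_sub_cancel, ← hK, ← Real.exp_add]
  exact Real.exp_le_one_iff.2 (by linarith)

theorem unique (hU : DependsOnFirst d r U) (hM : ∀ x, |U x| ≤ M)
    (hp : IsGibbsWeight d r U p) (hq : IsGibbsWeight d r U q)
    {A B : ℤ} (hAB : A ≤ B + 1) (x : Omega d) : p A B x = q A B x :=
  le_antisymm (hp.le_other hU hM hq hAB x) (hq.le_other hU hM hp hAB x)

theorem shift (hp : IsGibbsWeight d r U p) :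
    IsGibbsWeight d r U fun A B x => p (A + 1) (B + 1) (tauZ d (-1) x) where
  nonneg A B x hAB := hp.nonneg _ _ _ (by omega)
  congr A B x y hxy := hp.congr _ _ _ _ fun j h1 h2 => hxy _ (by omega) (by omega)
  empty B x := hp.empty _ _
  right A B x hAB := by
    rw [hp.right _ _ _ (by omega)]
    refine Finset.sum_congr rfl fun s _ => ?_
    congr 1
    funext j
    simp only [tauZ, Function.update_apply]
    congr 1
    exact propext (by omega)
  left A B x hAB := by
    rw [hp.left _ _ _ (by omega), show A + 1 - 1 = A - 1 + 1 by ring]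
    refine Finset.sum_congr rfl fun s _ => ?_
    congr 1
    funext j
    simp only [tauZ, Function.update_apply]
    congr 1
    exact propext (by omega)
  gibbs A B x y hAB hxy := by
    rw [← Vfun_shift x y (-1)]
    exact hp.gibbs _ _ _ _ (by omega) fun j hj => by
      have := hxy _ hj
      omega

end IsGibbsWeight

theorem measurableSet_intervalCyl (d : ℕ) (A B : ℤ) (x : Omega d) :
    MeasurableSet (intervalCyl d A B x) := by
  have h : intervalCyl d A B x = ⋂ j ∈ Set.Icc A B, (fun z : Omega d => z j) ⁻¹' {x j} := by
    ext z
    simp [intervalCyl]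
  rw [h]
  exact MeasurableSet.biInter (Set.to_countable _) fun j _ =>
    measurable_pi_apply j (measurableSet_singleton _)

theorem intervalCyl_congr {d : ℕ} {A B : ℤ} {x y : Omega d}
    (h : ∀ j, A ≤ j → j ≤ B → x j = y j) : intervalCyl d A B x = intervalCyl d A B y := by
  ext z
  exact forall₃_congr fun j h1 h2 => by rw [h j h1 h2]

theorem futureCyl_eq_intervalCyl (d s : ℕ) (a : ℕ → Fin d) (x : Omega d)
    (h : ∀ k : ℕ, 1 ≤ k → k ≤ s → x (k : ℤ) = a k) :
    futureCyl d s a = intervalCyl d 1 s x := by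
  ext z
  constructor
  · intro hz j h1 h2
    lift j to ℕ using by omega
    rw [hz j (by omega) (by omega), h j (by omega) (by omega)]
  · intro hz k h1 h2
    rw [hz k (by omega) (by omega), h k h1 h2]

/-- A cylinder splits according to the value of one further coordinate. -/
theorem measureReal_intervalCyl_eq_sum {d : ℕ} (α : Measure (Omega d)) [IsProbabilityMeasure α]
    {A B A' B' i : ℤ} (x : Omega d) (hi : ¬ (A ≤ i ∧ i ≤ B))
    (h : ∀ j, (A' ≤ j ∧ j ≤ B') ↔ (A ≤ j ∧ j ≤ B) ∨ j = i) :
    α.real (intervalCyl d A B x)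
      = ∑ s, α.real (intervalCyl d A' B' (Function.update x i s)) := by
  have hmem : ∀ z s, z ∈ intervalCyl d A' B' (Function.update x i s) ↔
      z ∈ intervalCyl d A B x ∧ z i = s := by
    intro z s
    constructor
    · intro hz
      refine ⟨fun j h1 h2 => ?_, ?_⟩
      · have hj := (h j).2 (Or.inl ⟨h1, h2⟩)
        have := hz j hj.1 hj.2
        rwa [Function.update_of_ne] at this
        rintro rfl
        exact hi ⟨h1, h2⟩
      · have hj := (h i).2 (Or.inr rfl)
        simpa using hz i hj.1 hj.2
    · rintro ⟨hz, rfl⟩ j h1 h2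
      by_cases hj : j = i
      · subst hj
        simp
      · rw [Function.update_of_ne hj]
        have := ((h j).1 ⟨h1, h2⟩).resolve_right hj
        exact hz j this.1 this.2
  rw [← measureReal_iUnion_fintype]
  · congr 1
    ext z
    simp only [Set.mem_iUnion, hmem]
    simp
  · intro s t hst
    rw [Function.onFun, Set.disjoint_left]
    intro z hz hz'
    exact hst (((hmem z s).1 hz).2.symm.trans ((hmem z t).1 hz').2)
  · exact fun s => measurableSet_intervalCyl _ _ _ _

theorem CStarGibbs.measureReal_symm {d r : ℕ} {U : Omega d → ℝ} {α : Measure (Omega d)}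
    (hG : CStarGibbs d U α) (hU : DependsOnFirst d r U) {N : ℕ} (hN : 1 ≤ N) {x y : Omega d}
    (hxy : ∀ j, x j ≠ y j → -(N : ℤ) + r ≤ j ∧ j ≤ N - r) :
    α.real (intervalCyl d (-N) N x) * Real.exp (-Vfun d U x y)
      = α.real (intervalCyl d (-N) N y) := by
  have h := hG N hN x y (fun _ => 1) continuous_const
  have hc : ∀ z, cyl d N N z = intervalCyl d (-N) N z := fun z => rfl
  rw [hc, hc] at h
  rw [setIntegral_congr_fun (g := fun _ => ((Real.exp (-Vfun d U x y) : ℝ) : ℂ))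
    (measurableSet_intervalCyl _ _ _ _) ?_, setIntegral_const, setIntegral_const] at h
  · rw [Complex.real_smul, Complex.real_smul, mul_one] at h
    exact_mod_cast h
  · intro z hz
    simp only [mul_one]
    rw [hU.Vfun_congr (A := -N) (B := N) (x' := x) (y' := y) ?_ hxy hz]
    · intro j h1 h2
      simp [conjMap, h1, h2]
    · intro j hj
      by_cases hj' : -(N : ℤ) ≤ j ∧ j ≤ N
      · rw [hz j hj'.1 hj'.2] at hj
        simp only [conjMap, hj', and_self, if_true] at hj
        exact hxy j hj
      · simp [conjMap, hj'] at hj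

/-- The cylinder probabilities of a C*-Gibbs probability form a Gibbs weight. -/
theorem CStarGibbs.isGibbsWeight {d r : ℕ} {U : Omega d → ℝ} {α : Measure (Omega d)}
    [IsProbabilityMeasure α] (hG : CStarGibbs d U α) (hU : DependsOnFirst d r U) :
    IsGibbsWeight d r U fun A B x => α.real (intervalCyl d A B x) := by
  have hright : ∀ A B (x : Omega d), A ≤ B + 1 → α.real (intervalCyl d A B x)
      = ∑ s, α.real (intervalCyl d A (B + 1) (Function.update x (B + 1) s)) := fun A B x hAB =>
    measureReal_intervalCyl_eq_sum α x (by omega) fun j => by omega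
  have hleft : ∀ A B (x : Omega d), A ≤ B + 1 → α.real (intervalCyl d A B x)
      = ∑ s, α.real (intervalCyl d (A - 1) B (Function.update x (A - 1) s)) := fun A B x hAB =>
    measureReal_intervalCyl_eq_sum α x (by omega) fun j => by omega
  refine ⟨fun A B x _ => measureReal_nonneg, fun A B x y h => by rw [intervalCyl_congr h],
    fun B x => ?_, hright, hleft, fun A B x y hAB => ?_⟩
  · have h : intervalCyl d (B + 1) B x = Set.univ := by
      ext z
      simp only [Set.mem_univ, iff_true]
      intro j h1 h2
      omega
    rw [h]
    simp
  · let R : ℤ → ℤ → Prop := fun A' B' => ∀ x y : Omega d,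
      (∀ j, x j ≠ y j → A' + r ≤ j ∧ j ≤ B' - r) →
      α.real (intervalCyl d A' B' x) * Real.exp (-Vfun d U x y)
        = α.real (intervalCyl d A' B' y)
    have hR : R A B := by
      obtain ⟨N, hN1, hNA, hNB⟩ : ∃ N : ℕ, 1 ≤ N ∧ -(N : ℤ) ≤ A ∧ B ≤ N :=
        ⟨A.natAbs + B.natAbs + 1, by omega, by omega, by omega⟩
      refine interval_descent (R := R) (fun A' B' hA hB h x' y' h1 => ?_)
        (fun A' B' hA hB h x' y' h1 => ?_) (A + N).toNat (N - B).toNat ?_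
      · rw [hright A' B' x' (by omega), hright A' B' y' (by omega), Finset.sum_mul]
        refine Finset.sum_congr rfl fun s _ => ?_
        have hs : ∀ j, Function.update x' (B' + 1) s j ≠ Function.update y' (B' + 1) s j →
            A' + r ≤ j ∧ j ≤ B' - r := fun j hj => by
          by_cases hj' : j = B' + 1
          · simp [hj'] at hj
          · exact h1 j (by simpa [hj'] using hj)
        rw [← h _ _ fun j hj => ⟨(hs j hj).1, by have := hs j hj; omega⟩]
        rw [hU.Vfun_congr h1 hs] <;>
          exact fun j _ _ => by rw [Function.update_of_ne (by omega)]
      · rw [hleft A' B' x' (by omega), hleft A' B' y' (by omega), Finset.sum_mul]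
        refine Finset.sum_congr rfl fun s _ => ?_
        have hs : ∀ j, Function.update x' (A' - 1) s j ≠ Function.update y' (A' - 1) s j →
            A' + r ≤ j ∧ j ≤ B' - r := fun j hj => by
          by_cases hj' : j = A' - 1
          · simp [hj'] at hj
          · exact h1 j (by simpa [hj'] using hj)
        rw [← h _ _ fun j hj => ⟨by have := hs j hj; omega, (hs j hj).2⟩]
        rw [hU.Vfun_congr h1 hs] <;>
          exact fun j _ _ => by rw [Function.update_of_ne (by omega)]
      · rw [show A - ((A + N).toNat : ℤ) = -N by omega, show B + ((N - B).toNat : ℤ) = N by omega]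
        exact fun x y hxy => hG.measureReal_symm hU hN1 hxy
    exact hR x y

theorem measurable_tau (d : ℕ) : Measurable (tau d) :=
  measurable_pi_lambda _ fun j => measurable_pi_apply (j + 1)

/-- Finite measures on the full shift are determined by their values on interval cylinders. -/
theorem measure_ext_of_intervalCyl {d : ℕ} (hd : 0 < d) {μ ν : Measure (Omega d)}
    [IsFiniteMeasure μ] [IsFiniteMeasure ν]
    (h : ∀ A B x, A ≤ B + 1 → μ (intervalCyl d A B x) = ν (intervalCyl d A B x)) : μ = ν := by
  refine IsProjectiveLimit.unique (P := fun I => μ.map I.restrict) (fun I => rfl) fun I => ?_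
  obtain ⟨N, hN⟩ : ∃ N : ℕ, I ⊆ Finset.Icc (-(N : ℤ)) N := by
    refine ⟨I.sup Int.natAbs, fun j hj => ?_⟩
    have := Finset.le_sup (f := Int.natAbs) hj
    rw [Finset.mem_Icc]
    omega
  have key : ν.map (Finset.Icc (-(N : ℤ)) N).restrict =
      μ.map (Finset.Icc (-(N : ℤ)) N).restrict := by
    refine Measure.ext_of_singleton fun w => ?_
    rw [Measure.map_apply (Finset.measurable_restrict _) (measurableSet_singleton _),
      Measure.map_apply (Finset.measurable_restrict _) (measurableSet_singleton _)]
    have hw : (Finset.Icc (-(N : ℤ)) N).restrict (π := fun _ => Fin d) ⁻¹' {w} =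
        intervalCyl d (-N) N fun j =>
        if hj : j ∈ Finset.Icc (-(N : ℤ)) N then w ⟨j, hj⟩ else ⟨0, hd⟩ := by
      ext z
      simp only [Set.mem_preimage, Set.mem_singleton_iff, intervalCyl, Set.mem_ofPred_eq]
      constructor
      · rintro rfl j h1 h2
        rw [dif_pos (Finset.mem_Icc.2 ⟨h1, h2⟩)]
        rfl
      · intro hz
        funext j
        have hj := Finset.mem_Icc.1 j.2
        have := hz j hj.1 hj.2
        rw [dif_pos j.2] at this
        exact this
    rw [hw, h _ _ _ (by omega)]
  have hcomp : (I.restrict : Omega d → _) =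
      Finset.restrict₂ hN ∘ (Finset.Icc (-(N : ℤ)) N).restrict := rfl
  change ν.map I.restrict = μ.map I.restrict
  rw [hcomp, ← Measure.map_map (Finset.measurable_restrict₂ _) (Finset.measurable_restrict _),
    ← Measure.map_map (Finset.measurable_restrict₂ _) (Finset.measurable_restrict _), key]

theorem CStarGibbs.map_tau_eq {d r : ℕ} (hd : 0 < d) {U : Omega d → ℝ} {α : Measure (Omega d)}
    [IsProbabilityMeasure α] (hG : CStarGibbs d U α) (hU : DependsOnFirst d r U) {M : ℝ}
    (hM : ∀ x, |U x| ≤ M) : Measure.map (tau d) α = α := by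
  have hp := hG.isGibbsWeight hU
  have : IsProbabilityMeasure (Measure.map (tau d) α) :=
    Measure.isProbabilityMeasure_map (measurable_tau d).aemeasurable
  refine measure_ext_of_intervalCyl hd fun A B x hAB => ?_
  rw [Measure.map_apply (measurable_tau d) (measurableSet_intervalCyl _ _ _ _)]
  have hpre : tau d ⁻¹' intervalCyl d A B x
      = intervalCyl d (A + 1) (B + 1) (tauZ d (-1) x) := by
    ext z
    constructor
    · intro hz j h1 h2
      have := hz (j + -1) (by omega) (by omega)
      simpa [tau, tauZ] using this
    · intro hz j h1 h2
      have := hz (j + 1) (by omega) (by omega)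
      simpa [tau, tauZ] using this
  rw [hpre]
  have := hp.shift.unique hU hM hp hAB x
  exact (measureReal_eq_measureReal_iff).1 this

/-- A sequence of reals that is additive up to a bounded error is linear up to a bounded error. -/
theorem exists_abs_sub_mul_le_of_quasi_additive {a : ℕ → ℝ} {κ : ℝ}
    (h : ∀ s t, |a (s + t) - (a s + a t)| ≤ κ) : ∃ P : ℝ, ∀ s, 1 ≤ s → |a s - P * s| ≤ κ := by
  have hκ : 0 ≤ κ := (abs_nonneg _).trans (h 0 0)
  have ha : ∀ n : ℕ, |a n| ≤ κ + n * (|a 1| + κ) := by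
    intro n
    induction n with
    | zero =>
      have := h 0 0
      rw [add_zero, sub_add_cancel_left, abs_neg] at this
      simpa using this
    | succ n ih =>
      have h1 := abs_le.1 (h n 1)
      have h2 := abs_le.1 ih
      have h3 := neg_abs_le (a 1)
      have h4 := le_abs_self (a 1)
      push_cast
      rw [abs_le]
      constructor <;> nlinarith
  have hbd : ∀ ε : ℝ, |ε| ≤ 1 → BddBelow (Set.range fun n : ℕ => (ε * a n + κ) / n) := by
    rintro ε hε
    refine ⟨-(2 * κ + |a 1|), ?_⟩
    rintro _ ⟨n, rfl⟩
    rcases Nat.eq_zero_or_pos n with rfl | hn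
    · simp only [Nat.cast_zero, div_zero]
      have := abs_nonneg (a 1)
      linarith
    · have hn' : (1 : ℝ) ≤ n := by exact_mod_cast hn
      have h0 : |ε * a n| ≤ κ + n * (|a 1| + κ) := by
        rw [abs_mul]
        exact (mul_le_of_le_one_left (abs_nonneg _) hε).trans (ha n)
      have h1 := (abs_le.1 h0).1
      simp only
      rw [le_div_iff₀ (by linarith)]
      nlinarith
  have hu : Subadditive fun n => 1 * a n + κ := fun s t => by
    have := abs_le.1 (h s t)
    simp only
    linarith
  have hv : Subadditive fun n => -1 * a n + κ := fun s t => by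
    have := abs_le.1 (h s t)
    simp only
    linarith
  have hbu := hbd 1 (by simp)
  have hbv := hbd (-1) (by simp)
  have hlim : hv.lim = -hu.lim := by
    have h1 := (hu.tendsto_lim hbu).add (hv.tendsto_lim hbv)
    have h2 : Tendsto (fun n : ℕ => 2 * κ / (n : ℝ)) atTop (nhds 0) :=
      tendsto_const_div_atTop_nhds_zero_nat _
    have h3 := tendsto_nhds_unique (h1.congr fun n => by ring) h2
    linarith
  refine ⟨hu.lim, fun s hs => ?_⟩
  have hs' : (0 : ℝ) < s := by exact_mod_cast hs
  have h1 := hu.lim_le_div hbu (n := s) (by omega)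
  have h2 := hv.lim_le_div hbv (n := s) (by omega)
  rw [hlim] at h2
  rw [le_div_iff₀ hs'] at h1 h2
  rw [abs_le]
  constructor <;> linarith

/-- The point reading the word `w` at the coordinates `1, …, s` and `c` elsewhere. -/
def wordPoint (d s : ℕ) (c : Fin d) (w : Fin s → Fin d) : Omega d :=
  fun j => if h : 1 ≤ j ∧ j ≤ s then w ⟨(j - 1).toNat, by omega⟩ else c

theorem wordPoint_apply {d s : ℕ} {c : Fin d} (w : Fin s → Fin d) (i : Fin s) :
    wordPoint d s c w ((i : ℤ) + 1) = w i := by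
  have h : (1 : ℤ) ≤ (i : ℤ) + 1 ∧ (i : ℤ) + 1 ≤ s := by omega
  rw [wordPoint, dif_pos h]
  congr 1
  ext
  simp

theorem sum_measureReal_wordPoint {d : ℕ} (α : Measure (Omega d)) [IsProbabilityMeasure α]
    (s : ℕ) (c : Fin d) :
    ∑ w : Fin s → Fin d, α.real (intervalCyl d 1 s (wordPoint d s c w)) = 1 := by
  let g : Omega d → Fin s → Fin d := fun z i => z ((i : ℤ) + 1)
  have hg : ∀ w, g ⁻¹' {w} = intervalCyl d 1 s (wordPoint d s c w) := by
    intro w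
    ext z
    simp only [Set.mem_preimage, Set.mem_singleton_iff]
    constructor
    · rintro rfl j h1 h2
      rw [wordPoint, dif_pos ⟨h1, h2⟩]
      simp only [g]
      congr 1
      omega
    · intro hz
      funext i
      exact (hz _ (by omega) (by omega)).trans (wordPoint_apply w i)
  have h := sum_measureReal_preimage_singleton (μ := α) (f := g) Finset.univ fun w _ => by
    rw [hg]
    exact measurableSet_intervalCyl _ _ _ _
  simpa [hg] using h

/-- The partition function of the words of length `s` with constant exterior `c`. -/
def partitionSum (d : ℕ) (U : Omega d → ℝ) (c : Fin d) (s : ℕ) : ℝ :=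
  ∑ w : Fin s → Fin d, Real.exp (birkhoff d U s (wordPoint d s c w))

section Bowen

variable {d r : ℕ} {U : Omega d → ℝ} {M : ℝ}

theorem partitionSum_pos (c : Fin d) (s : ℕ) : 0 < partitionSum d U c s :=
  Finset.sum_pos (fun _ _ => Real.exp_pos _) ⟨fun _ => c, Finset.mem_univ _⟩

theorem DependsOnFirst.abs_birkhoff_append_sub_le (hU : DependsOnFirst d r U)
    (hM : ∀ x, |U x| ≤ M) (c : Fin d) {s t : ℕ} (w : Fin s → Fin d) (w' : Fin t → Fin d) :
    |birkhoff d U (s + t) (wordPoint d (s + t) c (Fin.append w w')) -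
      (birkhoff d U s (wordPoint d s c w) + birkhoff d U t (wordPoint d t c w'))|
      ≤ 4 * M * r := by
  rw [birkhoff_add]
  have h1 := abs_le.1 <| hU.abs_birkhoff_sub_le hM (s := s)
    (x := wordPoint d (s + t) c (Fin.append w w')) (y := wordPoint d s c w) fun j h1 h2 => by
      obtain ⟨i, rfl⟩ : ∃ i : Fin s, j = (i : ℤ) + 1 :=
        ⟨⟨(j - 1).toNat, by omega⟩, by simp only; omega⟩
      rw [wordPoint_apply]
      exact (wordPoint_apply (Fin.append w w') (Fin.castAdd t i)).trans (Fin.append_left _ _ _)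
  have h2 := abs_le.1 <| hU.abs_birkhoff_sub_le hM (s := t)
    (x := tauZ d s (wordPoint d (s + t) c (Fin.append w w')))
    (y := wordPoint d t c w') fun j h1 h2 => by
      obtain ⟨i, rfl⟩ : ∃ i : Fin t, j = (i : ℤ) + 1 :=
        ⟨⟨(j - 1).toNat, by omega⟩, by simp only; omega⟩
      rw [wordPoint_apply, ← Fin.append_right w w' i, ← wordPoint_apply (c := c) (Fin.append w w')]
      simp only [tauZ, Fin.val_natAdd]
      congr 1
      push_cast
      ring
  rw [abs_le]
  constructor <;> linarith

theorem DependsOnFirst.abs_log_partitionSum_add_sub_le (hU : DependsOnFirst d r U)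
    (hM : ∀ x, |U x| ≤ M) (c : Fin d) (s t : ℕ) :
    |Real.log (partitionSum d U c (s + t)) -
      (Real.log (partitionSum d U c s) + Real.log (partitionSum d U c t))| ≤ 4 * M * r := by
  have hs := partitionSum_pos (U := U) c s
  have ht := partitionSum_pos (U := U) c t
  have hst := partitionSum_pos (U := U) c (s + t)
  have e1 : partitionSum d U c (s + t) = ∑ w : (Fin s → Fin d) × (Fin t → Fin d),
      Real.exp (birkhoff d U (s + t) (wordPoint d (s + t) c (Fin.append w.1 w.2))) :=
    ((Fin.appendEquiv s t).sum_comp _).symm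
  have e2 : partitionSum d U c s * partitionSum d U c t
      = ∑ w : (Fin s → Fin d) × (Fin t → Fin d), Real.exp
        (birkhoff d U s (wordPoint d s c w.1) + birkhoff d U t (wordPoint d t c w.2)) := by
    simp only [partitionSum, Finset.sum_mul_sum, Fintype.sum_prod_type, Real.exp_add]
  have hle : partitionSum d U c (s + t)
      ≤ Real.exp (4 * M * r) * (partitionSum d U c s * partitionSum d U c t) := by
    rw [e1, e2, Finset.mul_sum]
    refine Finset.sum_le_sum fun w _ => ?_
    rw [← Real.exp_add, Real.exp_le_exp]
    have := abs_le.1 (hU.abs_birkhoff_append_sub_le hM c w.1 w.2)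
    linarith
  have hge : partitionSum d U c s * partitionSum d U c t
      ≤ Real.exp (4 * M * r) * partitionSum d U c (s + t) := by
    rw [e1, e2, Finset.mul_sum]
    refine Finset.sum_le_sum fun w _ => ?_
    rw [← Real.exp_add, Real.exp_le_exp]
    have := abs_le.1 (hU.abs_birkhoff_append_sub_le hM c w.1 w.2)
    linarith
  have l1 := Real.log_le_log hst hle
  have l2 := Real.log_le_log (mul_pos hs ht) hge
  rw [Real.log_mul (Real.exp_ne_zero _) (mul_pos hs ht).ne', Real.log_exp,
    Real.log_mul hs.ne' ht.ne'] at l1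
  rw [Real.log_mul (Real.exp_ne_zero _) hst.ne', Real.log_exp,
    Real.log_mul hs.ne' ht.ne'] at l2
  rw [abs_le]
  constructor <;> linarith

theorem IsGibbsWeight.mul_exp_birkhoff_le {p : ℤ → ℤ → Omega d → ℝ}
    (hp : IsGibbsWeight d r U p) (hU : DependsOnFirst d r U) (hM : ∀ x, |U x| ≤ M)
    (s : ℕ) (x y : Omega d) :
    p 1 s x * Real.exp (birkhoff d U s y)
      ≤ Real.exp (4 * M * (2 * (r + 1)) + 4 * M * r) *
        (p 1 s y * Real.exp (birkhoff d U s x)) := by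
  have hy : ∀ j : ℤ, 1 ≤ j → j ≤ s → y j = splice d 1 s y x j := fun j h1 h2 => by
    simp [splice, h1, h2]
  have hx : ∀ j, x j ≠ splice d 1 s y x j → 1 ≤ j ∧ j ≤ s := fun j hj => by
    by_contra h
    simp [splice, h] at hj
  rw [hp.congr 1 s y _ hy]
  have h1 := hp.le_exp_mul hU hM (by omega) hx
  have h2 := abs_le.1 (hU.abs_Vfun_sub_birkhoff_le hM hx)
  have h3 := abs_le.1 (hU.abs_birkhoff_sub_le hM hy)
  refine (mul_le_mul_of_nonneg_right h1 (Real.exp_nonneg _)).trans ?_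
  rw [mul_right_comm, ← Real.exp_add, mul_comm (p _ _ _), ← mul_assoc (Real.exp _) (Real.exp _),
    ← Real.exp_add]
  refine mul_le_mul_of_nonneg_right ?_ (hp.nonneg _ _ _ (by omega))
  rw [Real.exp_le_exp]
  linarith

theorem CStarGibbs.exists_bowen_bounds {α : Measure (Omega d)} [IsProbabilityMeasure α]
    (hG : CStarGibbs d U α) (hd : 0 < d) (hU : DependsOnFirst d r U) (hM : ∀ x, |U x| ≤ M) :
    ∃ K P : ℝ, ∀ (s : ℕ) (x : Omega d), 1 ≤ s →
      Real.exp (-K) ≤ α.real (intervalCyl d 1 s x) * Real.exp (P * s - birkhoff d U s x) ∧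
      α.real (intervalCyl d 1 s x) * Real.exp (P * s - birkhoff d U s x) ≤ Real.exp K := by
  let c : Fin d := ⟨0, hd⟩
  obtain ⟨P, hP⟩ := exists_abs_sub_mul_le_of_quasi_additive
    (a := fun s => Real.log (partitionSum d U c s))
    (hU.abs_log_partitionSum_add_sub_le hM c)
  set L := 4 * M * (2 * ((r : ℝ) + 1)) + 4 * M * r with hL
  have hp := hG.isGibbsWeight hU
  refine ⟨L + 4 * M * r, P, fun s x hs => ?_⟩
  have hZ := partitionSum_pos (U := U) c s
  have hPs := abs_le.1 (hP s hs)
  have h1 : α.real (intervalCyl d 1 s x) * partitionSum d U c s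
      ≤ Real.exp L * Real.exp (birkhoff d U s x) := by
    rw [partitionSum, Finset.mul_sum, ← mul_one (Real.exp L * _),
      ← sum_measureReal_wordPoint α s c, Finset.mul_sum]
    refine Finset.sum_le_sum fun w _ =>
      (hp.mul_exp_birkhoff_le hU hM s x (wordPoint d s c w)).trans (le_of_eq ?_)
    ring
  have h2 : Real.exp (birkhoff d U s x)
      ≤ Real.exp L * (α.real (intervalCyl d 1 s x) * partitionSum d U c s) := by
    rw [partitionSum, Finset.mul_sum, Finset.mul_sum, ← one_mul (Real.exp (birkhoff d U s x)),
      ← sum_measureReal_wordPoint α s c, Finset.sum_mul]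
    exact Finset.sum_le_sum fun w _ => hp.mul_exp_birkhoff_le hU hM s (wordPoint d s c w) x
  rw [← Real.exp_log hZ] at h1 h2
  set l := Real.log (partitionSum d U c s)
  set b := birkhoff d U s x
  set m := α.real (intervalCyl d 1 s x)
  have hm : 0 ≤ m := measureReal_nonneg
  constructor
  · have h3 : Real.exp (-L - l + b) ≤ m := by
      have e : Real.exp (-L - l + b) = Real.exp (-L - l) * Real.exp b := Real.exp_add _ _
      rw [e]
      refine (mul_le_mul_of_nonneg_left h2 (Real.exp_nonneg _)).trans (le_of_eq ?_)
      rw [show Real.exp (-L - l) * (Real.exp L * (m * Real.exp l))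
        = m * (Real.exp (-L - l) * Real.exp L * Real.exp l) by ring, ← Real.exp_add,
        ← Real.exp_add, show -L - l + L + l = 0 by ring, Real.exp_zero, mul_one]
    refine le_trans ?_ (mul_le_mul_of_nonneg_right h3 (Real.exp_nonneg _))
    rw [← Real.exp_add, Real.exp_le_exp]
    linarith
  · have h3 : m ≤ Real.exp (L + b - l) := by
      rw [Real.exp_sub, le_div_iff₀ (Real.exp_pos _), Real.exp_add]
      exact h1
    refine (mul_le_mul_of_nonneg_right h3 (Real.exp_nonneg _)).trans ?_
    rw [← Real.exp_add, Real.exp_le_exp]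
    linarith

end Bowen

/-- If `U(x) = f(x₁,…,x_r)` and `α` is C*-Gibbs for `U`, then `α`
is the equilibrium probability for `U`. -/
theorem cstarGibbs_implies_equilibrium (d : ℕ) (hd : 2 ≤ d) (r : ℕ) (hr : 1 ≤ r)
    (f : (Fin r → Fin d) → ℝ) (U : Omega d → ℝ)
    (hUf : ∀ x : Omega d, U x = f (fun i => x (((i : ℕ) : ℤ) + 1)))
    (α : Measure (Omega d)) (hα : IsProbabilityMeasure α)
    (hGibbs : CStarGibbs d U α) :
    IsEquilibrium d U α := by
  have hU : DependsOnFirst d r U := fun x y h => by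
    rw [hUf, hUf]
    congr 1
    funext i
    exact h _ (by omega) (by omega)
  have hd0 : 0 < d := by omega
  have : Nonempty (Fin r → Fin d) := ⟨fun _ => ⟨0, hd0⟩⟩
  obtain ⟨M, hM⟩ : ∃ M, ∀ x, |U x| ≤ M := by
    obtain ⟨w, hw⟩ := Finite.exists_max fun w => |f w|
    exact ⟨|f w|, fun x => by rw [hUf]; exact hw _⟩
  refine ⟨hGibbs.map_tau_eq hd0 hU hM, ?_⟩
  obtain ⟨K, P, hK⟩ := hGibbs.exists_bowen_bounds hd0 hU hM
  refine ⟨Real.exp (-K), Real.exp K, P, Real.exp_pos _, Real.exp_pos _, fun s hs a x hx => ?_⟩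
  rw [futureCyl_eq_intervalCyl d s a x hx]
  exact hK s x hs
end
end
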